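/- arXiv:1705.09979 — 4 statements merged into one kernel-verified Lean document; each statement's English description precedes it below -/
import Mathlib

section
/- Let k ≥ 3. Then every finite simple graph on n ≥ k-1 vertices with at least (k-1)n - 1 edges contains a non-empty subgraph on at most (1 - 1/(10^4·k^2))·n vertices with minimum degree at least k. -/
namespace MinDeg

open Finset

variable {W : Type*} [DecidableEq W]

/-- Twice the excess of a set in a weighted multigraph. -/
def hh (g : W → ℕ) (m : W → W → ℕ) (S : Finset W) : ℤ :=
  2 * ∑ u ∈ S, (g u : ℤ) - ∑ u ∈ S, ∑ v ∈ S, (m u v : ℤ)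

/-- Closed sets: no outside vertex is killed. -/
def Cl (g : W → ℕ) (m : W → W → ℕ) (S : Finset W) : Prop :=
  ∀ u, u ∉ S → ∑ v ∈ S, m v u < g u

lemma hh_insert (g : W → ℕ) (m : W → W → ℕ) (hs : ∀ u v, m u v = m v u)
    (h0 : ∀ u, m u u = 0) (S : Finset W) (u : W) (hu : u ∉ S) :
    hh g m (insert u S) = hh g m S + 2 * (g u : ℤ) - 2 * ∑ v ∈ S, (m v u : ℤ) := by
  unfold hh
  rw [sum_insert hu, sum_insert hu, sum_insert hu]
  have : ∀ x ∈ S, ∑ v ∈ insert u S, (m x v : ℤ) = m x u + ∑ v ∈ S, (m x v : ℤ) := by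
    intro x _; rw [sum_insert hu]
  rw [sum_congr rfl this, sum_add_distrib]
  have h2 : ∑ v ∈ S, (m u v : ℤ) = ∑ v ∈ S, (m v u : ℤ) := by
    apply sum_congr rfl; intro x _; rw [hs]
  rw [h2, h0]
  push_cast
  ring

lemma hh_union (g : W → ℕ) (m : W → W → ℕ) (hs : ∀ u v, m u v = m v u)
    (S T : Finset W) (hd : Disjoint S T) :
    hh g m (S ∪ T) = hh g m S + hh g m T - 2 * ∑ u ∈ S, ∑ v ∈ T, (m v u : ℤ) := by
  unfold hh
  rw [sum_union hd, sum_union hd]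
  simp only [sum_union hd, sum_add_distrib]
  have h1 : ∑ u ∈ S, ∑ v ∈ T, (m v u : ℤ) = ∑ u ∈ S, ∑ v ∈ T, (m u v : ℤ) := by
    apply sum_congr rfl; intro x _; apply sum_congr rfl; intro y _; rw [hs]
  have h2 : ∑ u ∈ T, ∑ v ∈ S, (m u v : ℤ) = ∑ u ∈ S, ∑ v ∈ T, (m v u : ℤ) := by
    rw [sum_comm]
  rw [h2, h1]
  ring

/-- growing a set inside an allowed region without increasing `hh`. -/
lemma grow [Fintype W] (g : W → ℕ) (m : W → W → ℕ) (hs : ∀ u v, m u v = m v u)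
    (h0 : ∀ u, m u u = 0) (S0 C : Finset W) (hSC : S0 ⊆ C) :
    ∃ S, S0 ⊆ S ∧ S ⊆ C ∧ hh g m S ≤ hh g m S0 ∧
      ∀ u, u ∉ S → g u ≤ ∑ v ∈ S, m v u → u ∉ C := by
  classical
  obtain ⟨S, hS, hmax⟩ := exists_max_image
    ((univ : Finset (Finset W)).filter (fun S => S0 ⊆ S ∧ S ⊆ C ∧ hh g m S ≤ hh g m S0))
    Finset.card ⟨S0, by simp [hSC]⟩
  simp only [mem_filter, mem_univ, true_and] at hS hmax
  refine ⟨S, hS.1, hS.2.1, hS.2.2, ?_⟩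
  intro u hu hk huC
  have := hmax (insert u S) ⟨hS.1.trans (subset_insert _ _), insert_subset huC hS.2.1, by
    rw [hh_insert g m hs h0 S u hu]
    have : (g u : ℤ) ≤ ∑ v ∈ S, (m v u : ℤ) := by exact_mod_cast hk
    linarith [hS.2.2]⟩
  rw [card_insert_of_notMem hu] at this
  omega

/-- basic count: number of partners is at most `k * e`. -/
lemma cnt_one {ι : Type*} (C : Finset ι) (a : ι → ℕ) (γ e k : ℕ) (hk : 1 ≤ k)
    (ha : ∀ c ∈ C, a c < γ) (he : e < γ) (hsum : 2 ≤ γ → ∑ c ∈ C, a c + e + 1 ≤ γ + k) :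
    (C.filter (fun c => γ ≤ a c + e)).card ≤ k * e := by
  rcases Nat.eq_zero_or_pos e with h | h
  · subst h
    rw [filter_eq_empty_iff.2]
    · simp
    · intro c hc; have := ha c hc; omega
  · have hγ : 2 ≤ γ := by omega
    have h1 := hsum hγ
    have h2 : (C.filter (fun c => γ ≤ a c + e)).card * (γ - e) ≤ ∑ c ∈ C, a c := by
      calc _ ≤ ∑ c ∈ C.filter (fun c => γ ≤ a c + e), a c := by
            rw [← smul_eq_mul]
            apply card_nsmul_le_sum
            intro c hc
            have := (mem_filter.1 hc).2
            omega
        _ ≤ _ := sum_le_sum_of_subset (filter_subset _ _)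
    set N := (C.filter (fun c => γ ≤ a c + e)).card
    obtain ⟨z, hz⟩ : ∃ z, γ = e + z + 1 := ⟨γ - e - 1, by omega⟩
    have h3 : N * (z + 1) ≤ z + k := by
      have : γ - e = z + 1 := by omega
      rw [this] at h2; omega
    have h4 : N ≤ k := by
      by_contra hlt
      push Not at hlt
      have : (k + 1) * (z + 1) ≤ N * (z + 1) := Nat.mul_le_mul_right _ hlt
      nlinarith
    nlinarith

lemma cnt_pairs {ι : Type*} [DecidableEq ι] (R : Finset W) (C : Finset ι) (a : ι → ℕ) (e : W → ℕ)
    (γ k : ℕ) (hk : 1 ≤ k)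
    (ha : ∀ c ∈ C, a c < γ) (he : ∀ x ∈ R, e x < γ)
    (hsum : 2 ≤ γ → ∑ c ∈ C, a c + ∑ x ∈ R, e x + 1 ≤ γ + k) :
    ((R ×ˢ C).filter (fun p => γ ≤ a p.2 + e p.1)).card ≤ k * ∑ x ∈ R, e x ∧
    ((R ×ˢ C).filter (fun p => γ ≤ a p.2 + e p.1)).card ≤ k * ∑ c ∈ C, a c := by
  have hcard : ((R ×ˢ C).filter (fun p => γ ≤ a p.2 + e p.1)).card =
      ∑ x ∈ R, (C.filter (fun c => γ ≤ a c + e x)).card := by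
    simp only [card_filter]
    rw [sum_product]
  have hcard2 : ((R ×ˢ C).filter (fun p => γ ≤ a p.2 + e p.1)).card =
      ∑ c ∈ C, (R.filter (fun x => γ ≤ e x + a c)).card := by
    simp only [card_filter]
    rw [sum_product_right]
    simp only [add_comm]
  constructor
  · rw [hcard, mul_sum]
    apply sum_le_sum
    intro x hx
    apply cnt_one C a γ (e x) k hk ha (he x hx)
    intro h
    have := hsum h
    have := single_le_sum (f := e) (fun i _ => Nat.zero_le _) hx
    omega
  · rw [hcard2, mul_sum]
    apply sum_le_sum
    intro c hc
    apply cnt_one R e γ (a c) k hk he (ha c hc)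
    intro h
    have := hsum h
    have := single_le_sum (f := a) (fun i _ => Nat.zero_le _) hc
    omega


variable {ι : Type*} [Fintype ι] [DecidableEq ι]

/-- weight towards the other colours and the other rejected seeds -/
def DD (m : W → W → ℕ) (T : ι → Finset W) (R : Finset W) (u : W) (p : W × ι) : ℕ :=
  ∑ c ∈ univ.erase p.2, ∑ v ∈ T c, m v u + ∑ x ∈ R.erase p.1, m x u

/-- `u` is killed by the pair `p`. -/
def NN (g : W → ℕ) (m : W → W → ℕ) (T : ι → Finset W) (p : W × ι) (u : W) : Prop :=
  u ≠ p.1 ∧ u ∉ T p.2 ∧ g u ≤ ∑ v ∈ T p.2, m v u + m p.1 u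

lemma DD_le (m : W → W → ℕ) (T : ι → Finset W) (R : Finset W) (u : W) (p : W × ι)
    (B : Finset W) (hT : ∀ c d, c ≠ d → Disjoint (T c) (T d)) (hR : ∀ c, Disjoint R (T c))
    (hpR : p.1 ∈ R)
    (hTB : ∀ c, T c ⊆ B) (hRB : R ⊆ B) :
    DD m T R u p ≤ ∑ v ∈ B \ insert p.1 (T p.2), m v u := by
  unfold DD
  rw [← sum_biUnion (f := fun v => m v u), ← sum_union]
  · apply sum_le_sum_of_subset
    intro v hv
    rw [mem_union, mem_biUnion] at hv
    rw [mem_sdiff, mem_insert]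
    rcases hv with ⟨c, hc, hv⟩ | hv
    · refine ⟨hTB c hv, ?_⟩
      rintro (h | h)
      · exact disjoint_left.1 (hR c) hpR (h ▸ hv)
      · exact disjoint_left.1 (hT c p.2 (mem_erase.1 hc).1) hv h
    · refine ⟨hRB (mem_of_mem_erase hv), ?_⟩
      rintro (h | h)
      · exact (mem_erase.1 hv).1 h
      · exact disjoint_left.1 (hR _) (mem_of_mem_erase hv) h
  · rw [disjoint_left]
    intro v hv hv2
    obtain ⟨c, hc, hv⟩ := mem_biUnion.1 hv
    exact disjoint_left.1 (hR c) (mem_of_mem_erase hv2) hv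
  · intro c _ d _ hcd
    exact hT c d hcd

lemma absorb (g : W → ℕ) (m : W → W → ℕ) (hs : ∀ u v, m u v = m v u)
    (B S0 S : Finset W) (h0S : S0 ⊆ S) (h0B : S0 ⊆ B) (hSB : Disjoint (S \ S0) B)
    (hh1 : hh g m S ≤ hh g m S0) :
    hh g m (B ∪ (S \ S0)) + 2 * ∑ u ∈ S \ S0, ∑ v ∈ B \ S0, (m v u : ℤ) ≤ hh g m B := by
  have e1 := hh_union g m hs (S \ S0) S0 sdiff_disjoint
  rw [sdiff_union_of_subset h0S] at e1
  have e2 := hh_union g m hs (S \ S0) B hSB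
  rw [union_comm] at e2
  have e3 : ∑ u ∈ S \ S0, ∑ v ∈ B, (m v u : ℤ) = ∑ u ∈ S \ S0, ∑ v ∈ B \ S0, (m v u : ℤ)
      + ∑ u ∈ S \ S0, ∑ v ∈ S0, (m v u : ℤ) := by
    rw [← sum_add_distrib]
    apply sum_congr rfl
    intro u _
    rw [sum_sdiff h0B]
  linarith

lemma count_ind [Fintype W] (g : W → ℕ) (m : W → W → ℕ) (hs : ∀ u v, m u v = m v u)
    (h0 : ∀ u, m u u = 0) (T : ι → Finset W) (R B0 : Finset W)
    (hT : ∀ c d, c ≠ d → Disjoint (T c) (T d)) (hR : ∀ c, Disjoint R (T c))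
    (hTB : ∀ c, T c ⊆ B0) (hRB : R ⊆ B0)
    (hconf : ∀ x ∈ R, ∀ c, ∀ S, Cl g m S → insert x (T c) ⊆ S →
      ∃ y ∈ S, y ∈ B0 ∧ y ∉ insert x (T c))
    (p0 : W × ι) (P : Finset (W × ι)) :
    P ⊆ R ×ˢ univ →
    ∃ (B : Finset W) (lab : W → W × ι) (α : ℕ), B0 ⊆ B ∧ (∀ u ∈ B \ B0, lab u ∈ P) ∧
      hh g m B + 2 * α ≤ hh g m B0 ∧
      hh g m B + 2 * ∑ u ∈ B \ B0, (DD m T R u (lab u) : ℤ) ≤ hh g m B0 ∧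
      ∃ A : Finset (W × ι), A.card ≤ α ∧ ∀ p ∈ P, p ∉ A →
        ∃ u ∈ B, NN g m T p u ∧ (u ∈ B0 ∨ lab u ≠ p) := by
  classical
  refine Finset.induction_on P ?_ ?_
  · intro _
    exact ⟨B0, fun _ => p0, 0, by simp⟩
  · intro p P hpP ih hsub
    obtain ⟨B, lab, α, hB, hlab, hα, hD, A, hA, hgood⟩ := ih ((subset_insert _ _).trans hsub)
    have hpR : p.1 ∈ R := (mem_product.1 (hsub (mem_insert_self _ _))).1
    by_cases hex : ∃ u ∈ B, NN g m T p u ∧ (u ∈ B0 ∨ lab u ≠ p)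
    · refine ⟨B, lab, α, hB, fun u hu => mem_insert_of_mem (hlab u hu), hα, hD, A, hA, ?_⟩
      intro p' hp' hpA
      rcases mem_insert.1 hp' with h | h
      · rw [h]; exact hex
      · exact hgood p' h hpA
    · set S0 := insert p.1 (T p.2) with hS0
      have hS0B0 : S0 ⊆ B0 := insert_subset (hRB hpR) (hTB _)
      have hS0B : S0 ⊆ B := hS0B0.trans hB
      obtain ⟨S, hS0S, hSC, hhS, hmax⟩ := grow g m hs h0 S0 (S0 ∪ Bᶜ) subset_union_left
      have hQB : Disjoint (S \ S0) B := by
        rw [disjoint_left]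
        intro v hv hvB
        rw [mem_sdiff] at hv
        rcases mem_union.1 (hSC hv.1) with h | h
        · exact hv.2 h
        · exact (mem_compl.1 h) hvB
      have hab := absorb g m hs B S0 S hS0S hS0B hQB hhS
      have hncl : ¬ Cl g m S := by
        intro hcl
        obtain ⟨y, hy, hyB, hyn⟩ := hconf p.1 hpR p.2 S hcl hS0S
        rcases mem_union.1 (hSC hy) with h | h
        · exact hyn h
        · exact (mem_compl.1 h) (hB hyB)
      unfold Cl at hncl
      push Not at hncl
      obtain ⟨u0, hu0S, hu0k⟩ := hncl
      have hu0C := hmax u0 hu0S hu0k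
      rw [mem_union, mem_compl] at hu0C
      push Not at hu0C
      obtain ⟨hu0S0, hu0B⟩ := hu0C
      have hx : p.1 ∉ T p.2 := disjoint_left.1 (hR _) hpR
      have hnot : ∑ v ∈ S0, m v u0 < g u0 := by
        by_contra hcon
        push Not at hcon
        rw [hS0, sum_insert hx] at hcon
        apply hex
        refine ⟨u0, hu0B, ⟨?_, ?_, by omega⟩, ?_⟩
        · intro h; exact hu0S0 (h ▸ mem_insert_self _ _)
        · intro h; exact hu0S0 (mem_insert_of_mem h)
        · by_cases h : u0 ∈ B0
          · exact Or.inl h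
          · refine Or.inr ?_
            intro h2
            exact hpP (h2 ▸ hlab u0 (mem_sdiff.2 ⟨hu0B, h⟩))
      have hone : (1 : ℤ) ≤ ∑ u ∈ S \ S0, ∑ v ∈ B \ S0, (m v u : ℤ) := by
        have e1 : ∑ v ∈ S \ S0, m v u0 + ∑ v ∈ S0, m v u0 = ∑ v ∈ S, m v u0 := sum_sdiff hS0S
        have e2 : 1 ≤ ∑ v ∈ S \ S0, m v u0 := by omega
        have e3 : ∑ v ∈ S \ S0, m v u0 ≤ ∑ u ∈ S \ S0, ∑ v ∈ B \ S0, m v u := by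
          apply sum_le_sum
          intro u _
          rw [hs]
          exact single_le_sum (f := fun v => m v u) (fun i _ => Nat.zero_le _)
            (mem_sdiff.2 ⟨hu0B, hu0S0⟩)
        exact_mod_cast e2.trans e3
      have hDD : ∑ u ∈ S \ S0, (DD m T R u p : ℤ) ≤
          ∑ u ∈ S \ S0, ∑ v ∈ B \ S0, (m v u : ℤ) := by
        apply sum_le_sum
        intro u _
        have := DD_le m T R u p B hT hR hpR (fun c => (hTB c).trans hB) (hRB.trans hB)
        exact_mod_cast this
      have hsd : (B ∪ (S \ S0)) \ B0 = (B \ B0) ∪ (S \ S0) := by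
        ext v
        simp only [mem_sdiff, mem_union]
        constructor
        · tauto
        · rintro (h | h)
          · tauto
          · refine ⟨Or.inr h, fun hv => ?_⟩
            exact disjoint_left.1 hQB (mem_sdiff.2 h) (hB hv)
      have hdis : Disjoint (B \ B0) (S \ S0) :=
        (hQB.mono_right sdiff_subset).symm
      refine ⟨B ∪ (S \ S0), fun u => if u ∈ S \ S0 then p else lab u, α + 1,
        hB.trans subset_union_left, ?_, ?_, ?_, insert p A, ?_, ?_⟩
      · intro u hu
        by_cases h : u ∈ S \ S0
        · simp only [h, if_true, mem_insert_self]
        · simp only [h, if_false]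
          rw [hsd, mem_union] at hu
          exact mem_insert_of_mem (hlab u (hu.resolve_right h))
      · push_cast
        linarith
      · rw [hsd, sum_union hdis]
        have e1 : ∑ u ∈ B \ B0, (DD m T R u (if u ∈ S \ S0 then p else lab u) : ℤ)
            = ∑ u ∈ B \ B0, (DD m T R u (lab u) : ℤ) := by
          apply sum_congr rfl
          intro u hu
          rw [if_neg (disjoint_left.1 hdis hu)]
        have e2 : ∑ u ∈ S \ S0, (DD m T R u (if u ∈ S \ S0 then p else lab u) : ℤ)
            = ∑ u ∈ S \ S0, (DD m T R u p : ℤ) := by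
          apply sum_congr rfl
          intro u hu
          rw [if_pos hu]
        rw [e1, e2]
        linarith
      · exact (card_insert_le _ _).trans (by omega)
      · intro p' hp' hpA
        rw [mem_insert] at hpA
        push Not at hpA
        obtain ⟨u, huB, hu1, hu2⟩ := hgood p' ((mem_insert.1 hp').resolve_left hpA.1) hpA.2
        refine ⟨u, mem_union_left _ huB, hu1, ?_⟩
        have : u ∉ S \ S0 := fun h => disjoint_left.1 hQB h huB
        simpa [this] using hu2

/-- total cross weight at `u` -/
def cd (m : W → W → ℕ) (T : ι → Finset W) (R : Finset W) (u : W) : ℕ :=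
  ∑ c ∈ univ.filter (fun c => u ∉ T c), ∑ v ∈ T c, m v u + ∑ x ∈ R.erase u, m x u

lemma sum_TR_le [Fintype W] (m : W → W → ℕ) (T : ι → Finset W) (R : Finset W) (u : W)
    (hT : ∀ c d, c ≠ d → Disjoint (T c) (T d)) (hR : ∀ c, Disjoint R (T c))
    (B : Finset W) (hTB : ∀ c, T c ⊆ B) (hRB : R ⊆ B) :
    ∑ c, ∑ v ∈ T c, m v u + ∑ x ∈ R, m x u ≤ ∑ v ∈ B, m v u := by
  rw [← sum_biUnion (f := fun v => m v u), ← sum_union]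
  · apply sum_le_sum_of_subset
    apply union_subset _ hRB
    intro v hv
    obtain ⟨c, _, hv⟩ := mem_biUnion.1 hv
    exact hTB c hv
  · rw [disjoint_left]
    intro v hv hv2
    obtain ⟨c, hc, hv⟩ := mem_biUnion.1 hv
    exact disjoint_left.1 (hR c) hv2 hv
  · intro c _ d _ hcd
    exact hT c d hcd

open Classical in
lemma n_le [Fintype W] (g : W → ℕ) (m : W → W → ℕ)
    (T : ι → Finset W) (R : Finset W) (k : ℕ) (hk : 1 ≤ k)
    (hdeg : ∀ u, 2 ≤ g u → ∑ v, m v u + 1 ≤ g u + k)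
    (hT : ∀ c d, c ≠ d → Disjoint (T c) (T d)) (hR : ∀ c, Disjoint R (T c))
    (hcl : ∀ c, Cl g m (T c)) (hseed : ∀ x ∈ R, ∀ u, u ≠ x → m x u < g u) (u : W) :
    2 * ((R ×ˢ (univ : Finset ι)).filter (fun p => NN g m T p u)).card ≤ k * cd m T R u := by
  have key := cnt_pairs (R.erase u) (univ.filter (fun c => u ∉ T c))
    (fun c => ∑ v ∈ T c, m v u) (fun x => m x u) (g u) k hk ?_ ?_ ?_
  · have hsub : (R ×ˢ (univ : Finset ι)).filter (fun p => NN g m T p u) ⊆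
      ((R.erase u) ×ˢ (univ.filter (fun c => u ∉ T c))).filter
        (fun p => g u ≤ (fun c => ∑ v ∈ T c, m v u) p.2 + (fun x => m x u) p.1) := by
      intro p hp
      obtain ⟨h1, h2, h3, h4⟩ := mem_filter.1 hp
      rw [mem_filter, mem_product, mem_erase, mem_filter]
      exact ⟨⟨⟨h2.symm, (mem_product.1 h1).1⟩, mem_univ _, h3⟩, h4⟩
    have := card_le_card hsub
    unfold cd
    rw [mul_add]
    have h1 := this.trans (le_of_eq_of_le (by congr) key.1)
    have h2 := this.trans (le_of_eq_of_le (by congr) key.2)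
    linarith
  · intro c hc
    exact hcl c u (mem_filter.1 hc).2
  · intro x hx
    exact hseed x (mem_of_mem_erase hx) u (mem_erase.1 hx).1.symm
  · intro h
    have h1 := hdeg u h
    have h2 := sum_TR_le m T R u hT hR univ (fun c => subset_univ _) (subset_univ _)
    have h3 : ∑ c ∈ univ.filter (fun c => u ∉ T c), ∑ v ∈ T c, m v u ≤ ∑ c, ∑ v ∈ T c, m v u :=
      sum_le_sum_of_subset (filter_subset _ _)
    have h4 : ∑ x ∈ R.erase u, m x u ≤ ∑ x ∈ R, m x u := sum_le_sum_of_subset (erase_subset _ _)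
    omega

open Classical in
lemma nother_le [Fintype W] (g : W → ℕ) (m : W → W → ℕ)
    (T : ι → Finset W) (R : Finset W) (k : ℕ) (hk : 1 ≤ k)
    (hdeg : ∀ u, 2 ≤ g u → ∑ v, m v u + 1 ≤ g u + k)
    (hT : ∀ c d, c ≠ d → Disjoint (T c) (T d)) (hR : ∀ c, Disjoint R (T c))
    (hcl : ∀ c, Cl g m (T c)) (hseed : ∀ x ∈ R, ∀ u, u ≠ x → m x u < g u) (u : W)
    (huR : u ∉ R) (huT : ∀ c, u ∉ T c) (p0 : W × ι) :
    ((R ×ˢ (univ : Finset ι)).filter (fun p => NN g m T p u ∧ p0 ≠ p)).card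
      ≤ k * DD m T R u p0 := by
  have hne : ∀ x ∈ R, u ≠ x := fun x hx h => huR (h ▸ hx)
  have key := cnt_pairs R (univ.erase p0.2)
    (fun c => ∑ v ∈ T c, m v u) (fun x => m x u) (g u) k hk ?_ ?_ ?_
  · have hsub : (R ×ˢ (univ : Finset ι)).filter (fun p => NN g m T p u ∧ p0 ≠ p) ⊆
      (R ×ˢ (univ.erase p0.2)).filter
        (fun p => g u ≤ (fun c => ∑ v ∈ T c, m v u) p.2 + (fun x => m x u) p.1) ∪
      ((R.erase p0.1).filter (fun x => 0 < m x u)).image (fun x => (x, p0.2)) := by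
      intro p hp
      obtain ⟨h1, ⟨h2, h3, h4⟩, h5⟩ := mem_filter.1 hp
      rw [mem_union]
      by_cases hc : p.2 = p0.2
      · right
        rw [mem_image]
        refine ⟨p.1, ?_, ?_⟩
        · rw [mem_filter, mem_erase]
          refine ⟨⟨?_, (mem_product.1 h1).1⟩, ?_⟩
          · intro h
            exact h5 (Prod.ext h.symm hc.symm)
          · have := hcl p.2 u (huT _)
            omega
        · rw [← hc]
      · left
        rw [mem_filter, mem_product, mem_erase]
        exact ⟨⟨(mem_product.1 h1).1, hc, mem_univ _⟩, h4⟩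
    have h1 := card_le_card hsub
    have h2 := (card_union_le ((R ×ˢ (univ.erase p0.2)).filter
        (fun p => g u ≤ (fun c => ∑ v ∈ T c, m v u) p.2 + (fun x => m x u) p.1))
        (((R.erase p0.1).filter (fun x => 0 < m x u)).image (fun x => (x, p0.2))))
    have h3 : (((R.erase p0.1).filter (fun x => 0 < m x u)).image (fun x => (x, p0.2))).card
        ≤ ∑ x ∈ R.erase p0.1, m x u := by
      refine card_image_le.trans ?_
      rw [card_filter]
      apply sum_le_sum
      intro x _
      split_ifs <;> omega
    have h4 := (h1.trans h2).trans (Nat.add_le_add (le_of_eq_of_le (by congr) key.2) h3)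
    unfold DD
    rw [mul_add]
    have h5 : ∑ x ∈ R.erase p0.1, m x u ≤ k * ∑ x ∈ R.erase p0.1, m x u :=
      Nat.le_mul_of_pos_left _ hk
    linarith
  · intro c hc
    exact hcl c u (huT c)
  · intro x hx
    exact hseed x hx u (hne x hx)
  · intro h
    have h1 := hdeg u h
    have h2 := sum_TR_le m T R u hT hR univ (fun c => subset_univ _) (subset_univ _)
    have h3 : ∑ c ∈ univ.erase p0.2, ∑ v ∈ T c, m v u ≤ ∑ c, ∑ v ∈ T c, m v u :=
      sum_le_sum_of_subset (erase_subset _ _)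
    omega

lemma cd_sum [Fintype W] (g : W → ℕ) (m : W → W → ℕ) (hs : ∀ u v, m u v = m v u)
    (T : ι → Finset W) (R : Finset W) (x0 : W)
    (hT : ∀ c d, c ≠ d → Disjoint (T c) (T d)) (hR : ∀ c, Disjoint R (T c))
    (hxR : x0 ∉ R) (hxT : ∀ c, x0 ∉ T c) (B0 : Finset W)
    (hB0 : B0 = insert x0 (R ∪ univ.biUnion T)) :
    hh g m B0 + ∑ u ∈ B0, (cd m T R u : ℤ) ≤
      ∑ c, hh g m (T c) + 2 * ∑ x ∈ R, (g x : ℤ) + 2 * g x0 := by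
  have hTB : ∀ c, T c ⊆ B0 := by
    intro c v hv
    rw [hB0]
    exact mem_insert_of_mem (mem_union_right _ (mem_biUnion.2 ⟨c, mem_univ _, hv⟩))
  have hRB : R ⊆ B0 := by
    intro v hv
    rw [hB0]
    exact mem_insert_of_mem (mem_union_left _ hv)
  have hpt : ∀ u ∈ B0, (cd m T R u : ℤ) + ∑ c, (if u ∈ T c then ∑ v ∈ T c, (m v u : ℤ) else 0)
      ≤ ∑ v ∈ B0, (m u v : ℤ) := by
    intro u _
    have h1 := sum_TR_le m T R u hT hR B0 hTB hRB
    have h2 : cd m T R u + ∑ c, (if u ∈ T c then ∑ v ∈ T c, m v u else 0) ≤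
        ∑ c, ∑ v ∈ T c, m v u + ∑ x ∈ R, m x u := by
      unfold cd
      have h4 : ∑ x ∈ R.erase u, m x u ≤ ∑ x ∈ R, m x u := sum_le_sum_of_subset (erase_subset _ _)
      have h5 : ∑ c ∈ univ.filter (fun c => u ∉ T c), ∑ v ∈ T c, m v u
          + ∑ c, (if u ∈ T c then ∑ v ∈ T c, m v u else 0) = ∑ c, ∑ v ∈ T c, m v u := by
        rw [sum_filter, ← sum_add_distrib]
        apply sum_congr rfl
        intro c _
        by_cases h : u ∈ T c <;> simp [h]
      omega
    have h3 : ∑ v ∈ B0, m v u = ∑ v ∈ B0, m u v := sum_congr rfl (fun v _ => hs _ _)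
    rw [h3] at h1
    have := h2.trans h1
    have h6 : ((cd m T R u + ∑ c, (if u ∈ T c then ∑ v ∈ T c, m v u else 0) : ℕ) : ℤ)
      ≤ ((∑ v ∈ B0, m u v : ℕ) : ℤ) := by exact_mod_cast this
    push_cast at h6
    exact h6
  have hsum := sum_le_sum hpt
  rw [sum_add_distrib, sum_comm (s := B0)] at hsum
  have hin : ∀ c ∈ (univ : Finset ι), ∑ u ∈ B0, (if u ∈ T c then ∑ v ∈ T c, (m v u : ℤ) else 0)
      = ∑ u ∈ T c, ∑ v ∈ T c, (m u v : ℤ) := by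
    intro c _
    rw [← sum_filter, filter_mem_eq_inter, inter_eq_right.2 (hTB c)]
    apply sum_congr rfl; intro x _; apply sum_congr rfl; intro y _; rw [hs]
  rw [sum_congr rfl hin] at hsum
  have hg : ∑ u ∈ B0, (g u : ℤ) = g x0 + ∑ x ∈ R, (g x : ℤ) + ∑ c, ∑ u ∈ T c, (g u : ℤ) := by
    rw [hB0, sum_insert, sum_union, sum_biUnion]
    · ring
    · intro c _ d _ hcd
      exact hT c d hcd
    · rw [disjoint_left]
      intro v hv hv2
      obtain ⟨c, hc, hv2⟩ := mem_biUnion.1 hv2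
      exact disjoint_left.1 (hR c) hv hv2
    · rw [mem_union, mem_biUnion]
      rintro (h | ⟨c, _, h⟩)
      · exact hxR h
      · exact hxT c h
  unfold hh
  rw [sum_sub_distrib, ← mul_sum, hg]
  linarith

lemma count_main [Fintype W] (g : W → ℕ) (m : W → W → ℕ) (hs : ∀ u v, m u v = m v u)
    (h0 : ∀ u, m u u = 0) (k F q : ℕ) (hk : 1 ≤ k)
    (hdeg : ∀ u, 2 ≤ g u → ∑ v, m v u + 1 ≤ g u + k)
    (hpos : ∀ S, -2 ≤ hh g m S)
    (T : ι → Finset W) (R : Finset W) (x0 : W)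
    (hT : ∀ c d, c ≠ d → Disjoint (T c) (T d)) (hR : ∀ c, Disjoint R (T c))
    (hcl : ∀ c, Cl g m (T c)) (hseed : ∀ x ∈ R, ∀ u, u ≠ x → m x u < g u)
    (hgF : ∀ x ∈ R, g x ≤ F) (hx0F : g x0 ≤ F)
    (hxR : x0 ∉ R) (hxT : ∀ c, x0 ∉ T c)
    (hq : ∑ c, hh g m (T c) ≤ 2 * F * q)
    (hconf : ∀ x ∈ R, ∀ c, ∀ S, Cl g m S → insert x (T c) ⊆ S →
      ∃ y ∈ S, y ∈ insert x0 (R ∪ univ.biUnion T) ∧ y ∉ insert x (T c)) :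
    R.card * Fintype.card ι ≤ (k + 1) * (F * (q + 1 + R.card) + 1) := by
  classical
  by_cases hne : Nonempty ι
  swap
  · rw [not_nonempty_iff] at hne
    simp
  obtain ⟨c0⟩ := hne
  obtain ⟨B0, hB0⟩ : ∃ B0, B0 = insert x0 (R ∪ univ.biUnion T) := ⟨_, rfl⟩
  rw [← hB0] at hconf
  have hTB : ∀ c, T c ⊆ B0 := by
    intro c v hv
    rw [hB0]
    exact mem_insert_of_mem (mem_union_right _ (mem_biUnion.2 ⟨c, mem_univ _, hv⟩))
  have hRB : R ⊆ B0 := by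
    intro v hv
    rw [hB0]
    exact mem_insert_of_mem (mem_union_left _ hv)
  obtain ⟨B, lab, α, hB, hlab, hα, hD, A, hA, hgood⟩ :=
    count_ind g m hs h0 T R B0 hT hR hTB hRB hconf (x0, c0) (R ×ˢ univ) subset_rfl
  have hcd := cd_sum g m hs T R x0 hT hR hxR hxT B0 hB0
  have hcov : R ×ˢ (univ : Finset ι) ⊆ A ∪
      (B0.biUnion (fun u => (R ×ˢ (univ : Finset ι)).filter (fun p => NN g m T p u)) ∪
      (B \ B0).biUnion
        (fun u => (R ×ˢ (univ : Finset ι)).filter (fun p => NN g m T p u ∧ lab u ≠ p))) := by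
    intro p hp
    by_cases hpA : p ∈ A
    · exact mem_union_left _ hpA
    · obtain ⟨u, huB, hN, hu⟩ := hgood p hp hpA
      apply mem_union_right
      by_cases h : u ∈ B0
      · exact mem_union_left _ (mem_biUnion.2 ⟨u, h, mem_filter.2 ⟨hp, hN⟩⟩)
      · exact mem_union_right _ (mem_biUnion.2 ⟨u, mem_sdiff.2 ⟨huB, h⟩,
          mem_filter.2 ⟨hp, hN, hu.resolve_left h⟩⟩)
  have hcard := card_le_card hcov
  rw [card_product, card_univ] at hcard
  have c1 := card_union_le A
      (B0.biUnion (fun u => (R ×ˢ (univ : Finset ι)).filter (fun p => NN g m T p u)) ∪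
      (B \ B0).biUnion
        (fun u => (R ×ˢ (univ : Finset ι)).filter (fun p => NN g m T p u ∧ lab u ≠ p)))
  have c2 := card_union_le
      (B0.biUnion (fun u => (R ×ˢ (univ : Finset ι)).filter (fun p => NN g m T p u)))
      ((B \ B0).biUnion
        (fun u => (R ×ˢ (univ : Finset ι)).filter (fun p => NN g m T p u ∧ lab u ≠ p)))
  have c3 : 2 * (B0.biUnion (fun u => (R ×ˢ (univ : Finset ι)).filter
      (fun p => NN g m T p u))).card ≤ k * ∑ u ∈ B0, cd m T R u := by
    refine (Nat.mul_le_mul_left 2 card_biUnion_le).trans ?_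
    rw [mul_sum, mul_sum]
    exact sum_le_sum (fun u _ => n_le g m T R k hk hdeg hT hR hcl hseed u)
  have c4 : ((B \ B0).biUnion (fun u => (R ×ˢ (univ : Finset ι)).filter
      (fun p => NN g m T p u ∧ lab u ≠ p))).card ≤ k * ∑ u ∈ B \ B0, DD m T R u (lab u) := by
    refine card_biUnion_le.trans ?_
    rw [mul_sum]
    apply sum_le_sum
    intro u hu
    have hu' := (mem_sdiff.1 hu).2
    exact nother_le g m T R k hk hdeg hT hR hcl hseed u (fun h => hu' (hRB h))
      (fun c h => hu' (hTB c h)) (lab u)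
  have hB2 := hpos B
  have hgR : ∑ x ∈ R, (g x : ℤ) ≤ R.card * F := by
    rw [← nsmul_eq_mul]
    apply sum_le_card_nsmul
    intro x hx
    exact_mod_cast hgF x hx
  have hx0F' : (g x0 : ℤ) ≤ F := by exact_mod_cast hx0F
  obtain ⟨X, hX⟩ : ∃ X, X = ∑ u ∈ B0, cd m T R u := ⟨_, rfl⟩
  obtain ⟨Y, hY⟩ : ∃ Y, Y = ∑ u ∈ B \ B0, DD m T R u (lab u) := ⟨_, rfl⟩
  have hX' : ∑ u ∈ B0, (cd m T R u : ℤ) = X := by rw [hX]; push_cast; rfl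
  have hY' : ∑ u ∈ B \ B0, (DD m T R u (lab u) : ℤ) = Y := by rw [hY]; push_cast; rfl
  rw [hX'] at hcd
  rw [hY'] at hD
  rw [← hX] at c3
  rw [← hY] at c4
  have htot : 2 * (R.card * Fintype.card ι) ≤ 2 * α + k * X + 2 * (k * Y) := by omega
  have htot' : 2 * ((R.card : ℤ) * Fintype.card ι) ≤ 2 * α + k * X + 2 * (k * Y) := by
    exact_mod_cast htot
  have hM : hh g m B0 - hh g m B + X ≤ 2 * (F * (q + 1 + R.card) + 1) := by
    linarith
  have hkk : (k : ℤ) * (2 * Y + X) ≤ k * (2 * (F * (q + 1 + R.card) + 1)) := by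
    apply mul_le_mul_of_nonneg_left _ (by positivity)
    linarith
  have hXn : (0 : ℤ) ≤ X := by positivity
  have : ((R.card * Fintype.card ι : ℕ) : ℤ) ≤ (((k + 1) * (F * (q + 1 + R.card) + 1) : ℕ) : ℤ) := by
    push_cast
    linarith
  exact_mod_cast this

lemma colour_ind [Fintype W] (g : W → ℕ) (m : W → W → ℕ) (hs : ∀ u v, m u v = m v u)
    (h0 : ∀ u, m u u = 0) (k F : ℕ) (hk : 1 ≤ k) (hF : 1 ≤ F)
    (hJ : Fintype.card ι = 4 * (k + 1) * F)
    (hgpos : ∀ u, 0 < g u)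
    (hdeg : ∀ u, 2 ≤ g u → ∑ v, m v u + 1 ≤ g u + k)
    (hpos : ∀ S, -2 ≤ hh g m S)
    (w : W → ℕ) (x0 : W) (hx0F : g x0 ≤ F) (X : Finset W) :
    x0 ∉ X → (∀ x ∈ X, ∀ u, u ≠ x → m x u < g u) → (∀ x ∈ X, g x ≤ F) →
    ∃ (T : ι → Finset W) (R : Finset W) (q : ℕ),
      (∀ c d, c ≠ d → Disjoint (T c) (T d)) ∧ (∀ c, Disjoint R (T c)) ∧
      (∀ c, Cl g m (T c)) ∧ (∀ c, x0 ∉ T c) ∧ R ⊆ X ∧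
      (∑ c, hh g m (T c) ≤ 2 * F * q) ∧
      (∀ x ∈ R, ∀ c, ∀ S, Cl g m S → insert x (T c) ⊆ S →
        ∃ y ∈ S, y ∈ insert x0 (R ∪ univ.biUnion T) ∧ y ∉ insert x (T c)) ∧
      X ⊆ R ∪ univ.biUnion T ∧ R.card ≤ q ∧
      (∀ w0, (∀ x ∈ X, w0 ≤ w x) →
        ∑ x ∈ R, w x + (q - R.card) * w0 ≤ ∑ x ∈ X.filter (· ∈ univ.biUnion T), w x) := by
  classical
  refine Finset.induction_on_min_value w X ?_ ?_
  · intro _ _ _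
    refine ⟨fun _ => ∅, ∅, 0, ?_⟩
    simp [Cl, hh, hgpos]
  · intro a P haP hmin ih hx0 hseed hgF
    obtain ⟨T, R, q, hT, hR, hcl, hxT, hRP, hq, hconf, hcov, hRq, hw⟩ :=
      ih (fun h => hx0 (mem_insert_of_mem h)) (fun x hx => hseed x (mem_insert_of_mem hx))
        (fun x hx => hgF x (mem_insert_of_mem hx))
    have hax0 : a ≠ x0 := fun h => hx0 (h ▸ mem_insert_self _ _)
    have haR : a ∉ R := fun h => haP (hRP h)
    have hxR : x0 ∉ R := fun h => hx0 (mem_insert_of_mem (hRP h))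
    by_cases haT : a ∈ univ.biUnion T
    · refine ⟨T, R, q + 1, hT, hR, hcl, hxT, hRP.trans (subset_insert _ _), ?_, hconf, ?_, ?_, ?_⟩
      · push_cast
        have : (0 : ℤ) ≤ F := by positivity
        linarith
      · exact insert_subset (mem_union_right _ haT) hcov
      · omega
      · intro w0 hw0
        have h1 := hw w0 (fun x hx => hw0 x (mem_insert_of_mem hx))
        rw [filter_insert, if_pos haT, sum_insert (fun h => haP (mem_filter.1 h).1)]
        have h2 := hw0 a (mem_insert_self _ _)
        have h3 : q + 1 - R.card = (q - R.card) + 1 := by omega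
        rw [h3, add_mul]
        omega
    · by_cases hsucc : ∃ c S, Cl g m S ∧ insert a (T c) ⊆ S ∧
        ∀ y ∈ S, y ∈ insert x0 (insert a R ∪ univ.biUnion T) → y ∈ insert a (T c)
      · obtain ⟨c0, S, hSc, haS, hSav⟩ := hsucc
        obtain ⟨S2, hS2a, hS2S, hS2h, hS2m⟩ := grow g m hs h0 (insert a (T c0)) S haS
        have hS2c : Cl g m S2 := by
          intro u hu
          by_contra hcon
          push Not at hcon
          have h1 := hS2m u hu hcon
          have h2 := hSc u h1
          have h3 : ∑ v ∈ S2, m v u ≤ ∑ v ∈ S, m v u := sum_le_sum_of_subset hS2S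
          omega
        have hav : ∀ y ∈ S2, y ∈ insert x0 (R ∪ univ.biUnion T) → y ∈ insert a (T c0) := by
          intro y hy hy2
          apply hSav y (hS2S hy)
          simp only [mem_insert, mem_union] at hy2 ⊢
          tauto
        have haTc : ∀ c, a ∉ T c := fun c h => haT (mem_biUnion.2 ⟨c, mem_univ _, h⟩)
        have hav1 : ∀ y ∈ S2, y ∈ insert x0 (R ∪ univ.biUnion T) → y ∈ T c0 := by
          intro y hy hy2
          rcases mem_insert.1 (hav y hy hy2) with h | h
          · exfalso
            subst h
            rcases mem_insert.1 hy2 with h | h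
            · exact hax0 h
            · rcases mem_union.1 h with h | h
              · exact haR h
              · exact haT h
          · exact h
        have hTc0 : T c0 ⊆ S2 := (subset_insert _ _).trans hS2a
        have hmono : ∀ c, T c ⊆ Function.update T c0 S2 c := by
          intro c
          by_cases h : c = c0
          · subst h; simpa using hTc0
          · simp [h]
        have hmonoU : univ.biUnion T ⊆ univ.biUnion (Function.update T c0 S2) :=
          biUnion_mono (fun c _ => hmono c)
        have haT' : a ∈ univ.biUnion (Function.update T c0 S2) :=
          mem_biUnion.2 ⟨c0, mem_univ _, by simpa using hS2a (mem_insert_self _ _)⟩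
        have hdisS2 : ∀ c, c ≠ c0 → Disjoint S2 (T c) := by
          intro c hc
          rw [disjoint_left]
          intro v hv hvc
          have := hav1 v hv (mem_insert_of_mem (mem_union_right _ (mem_biUnion.2 ⟨c, mem_univ _, hvc⟩)))
          exact disjoint_left.1 (hT c c0 hc) hvc this
        refine ⟨Function.update T c0 S2, R, q + 1, ?_, ?_, ?_, ?_,
          hRP.trans (subset_insert _ _), ?_, ?_, ?_, by omega, ?_⟩
        · intro c d hcd
          by_cases hc : c = c0
          · subst hc
            rw [Function.update_self, Function.update_of_ne hcd.symm]
            exact hdisS2 d hcd.symm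
          · rw [Function.update_of_ne hc]
            by_cases hd : d = c0
            · subst hd
              rw [Function.update_self]
              exact (hdisS2 c hcd).symm
            · rw [Function.update_of_ne hd]
              exact hT c d hcd
        · intro c
          by_cases hc : c = c0
          · subst hc
            rw [Function.update_self, disjoint_right]
            intro v hv hvR
            have := hav1 v hv (mem_insert_of_mem (mem_union_left _ hvR))
            exact disjoint_left.1 (hR c) hvR this
          · rw [Function.update_of_ne hc]
            exact hR c
        · intro c
          by_cases hc : c = c0
          · subst hc
            rw [Function.update_self]
            exact hS2c
          · rw [Function.update_of_ne hc]
            exact hcl c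
        · intro c
          by_cases hc : c = c0
          · subst hc
            rw [Function.update_self]
            intro h
            exact hxT c (hav1 x0 h (mem_insert_self _ _))
          · rw [Function.update_of_ne hc]
            exact hxT c
        · have e1 := add_sum_erase univ (fun c => hh g m (Function.update T c0 S2 c)) (mem_univ c0)
          have e2 := add_sum_erase univ (fun c => hh g m (T c)) (mem_univ c0)
          have e3 : ∑ c ∈ univ.erase c0, hh g m (Function.update T c0 S2 c)
              = ∑ c ∈ univ.erase c0, hh g m (T c) := by
            apply sum_congr rfl
            intro c hc
            rw [Function.update_of_ne (mem_erase.1 hc).1]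
          simp only [Function.update_self] at e1
          have e4 := hh_insert g m hs h0 (T c0) a (haTc c0)
          have e5 : (0 : ℤ) ≤ ∑ v ∈ T c0, (m v a : ℤ) := sum_nonneg (fun _ _ => by positivity)
          have e6 : (g a : ℤ) ≤ F := by exact_mod_cast hgF a (mem_insert_self _ _)
          push_cast
          linarith
        · intro x hx c S' hS' hsub
          obtain ⟨y, hyS, hyB, hyn⟩ := hconf x hx c S' hS'
            ((insert_subset_insert _ (hmono c)).trans hsub)
          refine ⟨y, hyS, insert_subset_insert _ (union_subset_union_right hmonoU) hyB, ?_⟩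
          intro hy
          rcases mem_insert.1 hy with h | h
          · exact hyn (h ▸ mem_insert_self _ _)
          · by_cases hc : c = c0
            · subst hc
              rw [Function.update_self] at h
              exact hyn (mem_insert_of_mem (hav1 y h hyB))
            · rw [Function.update_of_ne hc] at h
              exact hyn (mem_insert_of_mem h)
        · exact insert_subset (mem_union_right _ haT')
            (hcov.trans (union_subset_union_right hmonoU))
        · intro w0 hw0
          have h1 := hw w0 (fun x hx => hw0 x (mem_insert_of_mem hx))
          rw [filter_insert, if_pos haT', sum_insert (fun h => haP (mem_filter.1 h).1)]
          have h2 := hw0 a (mem_insert_self _ _)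
          have h3 : q + 1 - R.card = (q - R.card) + 1 := by omega
          have h4 : ∑ x ∈ P.filter (· ∈ univ.biUnion T), w x ≤
              ∑ x ∈ P.filter (· ∈ univ.biUnion (Function.update T c0 S2)), w x := by
            apply sum_le_sum_of_subset
            intro x hx
            rw [mem_filter] at hx ⊢
            exact ⟨hx.1, hmonoU hx.2⟩
          rw [h3, add_mul]
          omega
      · push Not at hsucc
        have hconf' : ∀ x ∈ insert a R, ∀ c, ∀ S, Cl g m S → insert x (T c) ⊆ S →
            ∃ y ∈ S, y ∈ insert x0 (insert a R ∪ univ.biUnion T) ∧ y ∉ insert x (T c) := by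
          intro x hx c S hS hsub
          rcases mem_insert.1 hx with h | h
          · subst h
            exact hsucc c S hS hsub
          · obtain ⟨y, hyS, hyB, hyn⟩ := hconf x h c S hS hsub
            exact ⟨y, hyS, insert_subset_insert _
              (union_subset_union_left (subset_insert _ _)) hyB, hyn⟩
        have hR' : ∀ c, Disjoint (insert a R) (T c) := by
          intro c
          rw [disjoint_insert_left]
          exact ⟨fun h => haT (mem_biUnion.2 ⟨c, mem_univ _, h⟩), hR c⟩
        have hsubX : insert a R ⊆ insert a P := insert_subset_insert _ hRP
        have hcount := count_main g m hs h0 k F q hk hdeg hpos T (insert a R) x0 hT hR' hcl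
          (fun x hx => hseed x (hsubX hx)) (fun x hx => hgF x (hsubX hx)) hx0F
          (by rw [mem_insert]; rintro (h | h); exacts [hax0 h.symm, hxR h]) hxT hq hconf'
        rw [card_insert_of_notMem haR, hJ] at hcount
        have hr : R.card + 1 ≤ q := by
          have h1 : (k + 1) * ((R.card + 1) * (4 * F)) ≤
              (k + 1) * (F * (q + 1 + (R.card + 1)) + 1) := by
            calc _ = (R.card + 1) * (4 * (k + 1) * F) := by ring
              _ ≤ _ := hcount
          have h2 := Nat.le_of_mul_le_mul_left h1 (by omega)
          have h3 : F * (4 * (R.card + 1)) ≤ F * (q + 2 + (R.card + 1)) := by nlinarith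
          have h4 := Nat.le_of_mul_le_mul_left h3 (by omega)
          omega
        refine ⟨T, insert a R, q, hT, hR', hcl, hxT, hsubX, hq, hconf', ?_, ?_, ?_⟩
        · rw [insert_union]
          exact insert_subset_insert _ hcov
        · rw [card_insert_of_notMem haR]; exact hr
        · intro w0 hw0
          have h1 := hw (w a) hmin
          rw [filter_insert, if_neg haT, sum_insert haR, card_insert_of_notMem haR]
          have h2 := hw0 a (mem_insert_self _ _)
          have h3 : q - R.card = (q - (R.card + 1)) + 1 := by omega
          rw [h3, add_mul] at h1
          have h4 : (q - (R.card + 1)) * w0 ≤ (q - (R.card + 1)) * w a :=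
            Nat.mul_le_mul_left _ h2
          omega

/-- The colouring lemma: a closed set catching a large part of the weight of the seeds. -/
lemma colour [Fintype W] (g : W → ℕ) (m : W → W → ℕ) (hs : ∀ u v, m u v = m v u)
    (h0 : ∀ u, m u u = 0) (k F : ℕ) (hk : 1 ≤ k) (hF : 1 ≤ F)
    (hgpos : ∀ u, 0 < g u)
    (hdeg : ∀ u, 2 ≤ g u → ∑ v, m v u + 1 ≤ g u + k)
    (hpos : ∀ S, -2 ≤ hh g m S)
    (w : W → ℕ) (x0 : W) (hx0F : g x0 ≤ F) (X : Finset W) (hx0 : x0 ∉ X)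
    (hseed : ∀ x ∈ X, ∀ u, u ≠ x → m x u < g u) (hgF : ∀ x ∈ X, g x ≤ F) :
    ∃ U : Finset W, Cl g m U ∧ x0 ∉ U ∧
      ∑ x ∈ X, w x ≤ 8 * (k + 1) * F * ∑ x ∈ U, w x := by
  obtain ⟨T, R, q, hT, hR, hcl, hxT, hRX, hq, hconf, hcov, hRq, hw⟩ :=
    colour_ind (ι := Fin (4 * (k + 1) * F)) g m hs h0 k F hk hF (by simp) hgpos hdeg hpos w x0
      hx0F X hx0 hseed hgF
  have h1 := hw 0 (fun _ _ => Nat.zero_le _)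
  rw [mul_zero, add_zero] at h1
  have h2 : ∑ x ∈ X, w x ≤ ∑ x ∈ R, w x + ∑ x ∈ X.filter (· ∈ univ.biUnion T), w x := by
    rw [← sum_union]
    · apply sum_le_sum_of_subset
      intro x hx
      rcases mem_union.1 (hcov hx) with h | h
      · exact mem_union_left _ h
      · exact mem_union_right _ (mem_filter.2 ⟨hx, h⟩)
    · rw [disjoint_left]
      intro x hx hx2
      obtain ⟨c, _, hc⟩ := mem_biUnion.1 (mem_filter.1 hx2).2
      exact disjoint_left.1 (hR c) hx hc
  have h3 : ∑ x ∈ X.filter (· ∈ univ.biUnion T), w x ≤ ∑ c, ∑ x ∈ T c, w x := by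
    rw [← sum_biUnion]
    · apply sum_le_sum_of_subset
      intro x hx
      exact (mem_filter.1 hx).2
    · intro c _ d _ hcd
      exact hT c d hcd
  have hpJ : 0 < 4 * (k + 1) * F := by positivity
  haveI : Nonempty (Fin (4 * (k + 1) * F)) := ⟨⟨0, hpJ⟩⟩
  obtain ⟨c, _, hc⟩ := exists_max_image (univ : Finset (Fin (4 * (k + 1) * F)))
    (fun c => ∑ x ∈ T c, w x) univ_nonempty
  refine ⟨T c, hcl c, hxT c, ?_⟩
  have h4 : ∑ c, ∑ x ∈ T c, w x ≤ (4 * (k + 1) * F) * ∑ x ∈ T c, w x := by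
    have := sum_le_card_nsmul univ (fun c => ∑ x ∈ T c, w x) _ hc
    simpa using this
  calc _ ≤ 2 * ((4 * (k + 1) * F) * ∑ x ∈ T c, w x) := by omega
    _ = _ := by ring

lemma hh_submod (g : W → ℕ) (m : W → W → ℕ) (hs : ∀ u v, m u v = m v u) (S T : Finset W) :
    hh g m (S ∪ T) + hh g m (S ∩ T) ≤ hh g m S + hh g m T := by
  have e1 := hh_union g m hs (T \ S) S sdiff_disjoint
  have e2 := hh_union g m hs (T \ S) (T ∩ S) (by
    rw [disjoint_left]; intro v hv hv2
    exact (mem_sdiff.1 hv).2 (mem_inter.1 hv2).2)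
  rw [sdiff_union_self_eq_union, union_comm] at e1
  rw [sdiff_union_inter, inter_comm] at e2
  have e3 : ∑ u ∈ T \ S, ∑ v ∈ S ∩ T, (m v u : ℤ) ≤ ∑ u ∈ T \ S, ∑ v ∈ S, (m v u : ℤ) := by
    apply sum_le_sum
    intro u _
    apply sum_le_sum_of_subset_of_nonneg inter_subset_left
    intros; positivity
  linarith

section contraction

variable {V : Type*} [Fintype V] [DecidableEq V]

/-- preimage of a set of blocks -/
def pre (π : V → W) (S : Finset W) : Finset V := univ.filter (fun v => π v ∈ S)

/-- multiplicities of the contracted graph -/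
def mc (a : V → V → ℕ) (π : V → W) (p q : W) : ℕ :=
  if p = q then 0 else ∑ u ∈ pre π {p}, ∑ v ∈ pre π {q}, a u v

lemma mc_symm (a : V → V → ℕ) (hs : ∀ u v, a u v = a v u) (π : V → W) (p q : W) :
    mc a π p q = mc a π q p := by
  unfold mc
  by_cases h : p = q
  · simp [h]
  · rw [if_neg h, if_neg (Ne.symm h), sum_comm]
    apply sum_congr rfl; intro x _; apply sum_congr rfl; intro y _; rw [hs]

lemma pre_sum (π : V → W) (S : Finset W) (f : V → ℕ) :
    ∑ v ∈ pre π S, f v = ∑ p ∈ S, ∑ v ∈ pre π {p}, f v := by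
  have := sum_fiberwise_of_maps_to (s := pre π S) (t := S) (g := π)
    (fun v hv => (mem_filter.1 hv).2) f
  rw [← this]
  apply sum_congr rfl
  intro p hp
  apply sum_congr _ (fun _ _ => rfl)
  ext v
  simp only [pre, mem_filter, mem_univ, true_and, mem_singleton]
  constructor
  · exact fun h => h.2
  · intro h; exact ⟨h ▸ hp, h⟩

lemma mc_sum (a : V → V → ℕ) (π : V → W) (S : Finset W) (p : W) (hp : p ∉ S) :
    ∑ q ∈ S, mc a π q p = ∑ u ∈ pre π {p}, ∑ v ∈ pre π S, a v u := by
  rw [sum_comm, pre_sum]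
  apply sum_congr rfl
  intro q hq
  unfold mc
  have hne : q ≠ p := fun h => hp (h ▸ hq)
  rw [if_neg hne]

lemma hh_contract (g : V → ℕ) (a : V → V → ℕ) (hs : ∀ u v, a u v = a v u)
    (π : V → W) (g' : W → ℕ) (hg' : ∀ p, 2 * (g' p : ℤ) = hh g a (pre π {p})) (S : Finset W) :
    hh g' (mc a π) S = hh g a (pre π S) := by
  induction S using Finset.induction_on with
  | empty => simp [hh, pre]
  | insert p S hp ih =>
    rw [hh_insert g' (mc a π) (mc_symm a hs π) (by simp [mc]) S p hp, ih, hg']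
    have hpre : pre π (insert p S) = pre π {p} ∪ pre π S := by
      ext v; simp [pre]
    rw [hpre, hh_union g a hs]
    · have := mc_sum a π S p hp
      have h2 : ∑ q ∈ S, (mc a π q p : ℤ) = ∑ u ∈ pre π {p}, ∑ v ∈ pre π S, (a v u : ℤ) := by
        exact_mod_cast this
      rw [h2]; ring
    · rw [disjoint_left]
      intro v hv hv2
      simp only [pre, mem_filter, mem_univ, true_and, mem_singleton] at hv hv2
      exact hp (hv ▸ hv2)

end contraction

section basic

variable {V : Type*} [Fintype V] [DecidableEq V]

/-- twice the number of edges inside `S` -/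
def E2 (a : V → V → ℕ) (S : Finset V) : ℤ := ∑ u ∈ S, ∑ v ∈ S, (a u v : ℤ)

lemma E2_insert (a : V → V → ℕ) (hs : ∀ u v, a u v = a v u)
    (h0 : ∀ u, a u u = 0) (S : Finset V) (u : V) (hu : u ∉ S) :
    E2 a (insert u S) = E2 a S + 2 * ∑ v ∈ S, (a v u : ℤ) := by
  have := hh_insert (fun _ => 0) a hs h0 S u hu
  simp only [hh, Nat.cast_zero, sum_const_zero, mul_zero] at this
  unfold E2
  linarith

lemma E2_even (a : V → V → ℕ) (hs : ∀ u v, a u v = a v u)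
    (h0 : ∀ u, a u u = 0) (S : Finset V) : ∃ e : ℤ, E2 a S = 2 * e := by
  induction S using Finset.induction_on with
  | empty => exact ⟨0, by simp [E2]⟩
  | insert u S hu ih =>
    obtain ⟨e, he⟩ := ih
    exact ⟨e + ∑ v ∈ S, (a v u : ℤ), by rw [E2_insert a hs h0 S u hu, he]; ring⟩

/-- degree -/
def dg (a : V → V → ℕ) (u : V) : ℕ := ∑ v, a v u

lemma E2_compl (a : V → V → ℕ) (hs : ∀ u v, a u v = a v u) (S : Finset V) :
    E2 a univ - E2 a Sᶜ = 2 * ∑ u ∈ S, (dg a u : ℤ) - E2 a S := by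
  have h1 := hh_union (fun _ => 0) a hs S Sᶜ disjoint_compl_right
  rw [union_compl] at h1
  simp only [hh, Nat.cast_zero, sum_const_zero, mul_zero] at h1
  have h2 : ∑ u ∈ S, (dg a u : ℤ) = E2 a S + ∑ u ∈ S, ∑ v ∈ Sᶜ, (a v u : ℤ) := by
    unfold E2 dg
    rw [← sum_add_distrib]
    apply sum_congr rfl
    intro u _
    push_cast
    rw [← sum_add_sum_compl S]
    congr 1
    apply sum_congr rfl; intro v _; rw [hs]
  rw [h2]
  unfold E2
  linarith

end basic

section setup

variable {V : Type*} [Fintype V] [DecidableEq V]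

/-- A minimal dense graph, encoded by its 0/1 adjacency function. -/
structure Setup (k : ℕ) (a : V → V → ℕ) : Prop where
  hk : 3 ≤ k
  hs : ∀ u v, a u v = a v u
  h0 : ∀ u, a u u = 0
  h1 : ∀ u v, a u v ≤ 1
  hne : Nonempty V
  hE : 2 * ((k : ℤ) - 1) * Fintype.card V - 2 ≤ E2 a univ
  hmin : ∀ S : Finset V, S.Nonempty → S ≠ univ → E2 a S ≤ 2 * ((k : ℤ) - 1) * S.card - 4

/-- the budget of a vertex -/
def gg (k : ℕ) (a : V → V → ℕ) (u : V) : ℕ := dg a u - (k - 1)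

variable {k : ℕ} {a : V → V → ℕ}

lemma Setup.two_le (h : Setup k a) : 2 ≤ Fintype.card V := by
  by_contra hcon
  have hk := h.hk
  obtain ⟨v⟩ := h.hne
  have h1 : Fintype.card V = 1 := by
    have : 0 < Fintype.card V := Fintype.card_pos_iff.2 ⟨v⟩
    omega
  have hu : (univ : Finset V) = {v} := by
    symm
    rw [← card_eq_iff_eq_univ, card_singleton, h1]
  have hE := h.hE
  rw [hu, h1] at hE
  simp only [E2, sum_singleton, h.h0] at hE
  push_cast at hE
  have : (3 : ℤ) ≤ k := by exact_mod_cast hk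
  linarith

lemma Setup.compl_bound (h : Setup k a) (S : Finset V) (hS : S.Nonempty) (hS2 : S ≠ univ) :
    2 * ((k : ℤ) - 1) * S.card + 2 ≤ E2 a univ - E2 a Sᶜ := by
  have h1 := h.hmin Sᶜ (by
    rw [nonempty_iff_ne_empty, Ne, compl_eq_empty_iff]; exact hS2) (by
    rw [Ne, compl_eq_univ_iff]; exact hS.ne_empty)
  have hE := h.hE
  have hc : (Sᶜ.card : ℤ) = Fintype.card V - S.card := by
    have := card_add_card_compl S
    have : ((S.card + Sᶜ.card : ℕ) : ℤ) = Fintype.card V := by exact_mod_cast this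
    push_cast at this
    linarith
  rw [hc] at h1
  have : 2 * ((k : ℤ) - 1) * (Fintype.card V - S.card) =
    2 * ((k : ℤ) - 1) * Fintype.card V - 2 * ((k : ℤ) - 1) * S.card := by ring
  linarith

lemma Setup.dg_ge (h : Setup k a) (v : V) : k ≤ dg a v := by
  have h2 := h.two_le
  have hne : ({v} : Finset V) ≠ univ := by
    intro hcon
    have := congrArg Finset.card hcon
    rw [card_singleton, card_univ] at this
    omega
  have h3 := h.compl_bound {v} (singleton_nonempty _) hne
  rw [E2_compl a h.hs] at h3
  simp only [E2, sum_singleton, h.h0, card_singleton] at h3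
  push_cast at h3
  have : (k : ℤ) ≤ dg a v := by linarith
  exact_mod_cast this

lemma Setup.gg_cast (h : Setup k a) (v : V) : (gg k a v : ℤ) = dg a v - (k - 1) := by
  have := h.dg_ge v
  have := h.hk
  unfold gg
  omega

lemma Setup.gg_pos (h : Setup k a) (v : V) : 0 < gg k a v := by
  have := h.dg_ge v
  have := h.hk
  unfold gg
  omega

lemma Setup.hh_eq (h : Setup k a) (S : Finset V) :
    hh (gg k a) a S = E2 a univ - E2 a Sᶜ - 2 * ((k : ℤ) - 1) * S.card := by
  rw [E2_compl a h.hs]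
  unfold hh
  simp only [h.gg_cast, sum_sub_distrib, sum_const, nsmul_eq_mul]
  unfold E2
  ring

lemma Setup.hh_ge (h : Setup k a) (S : Finset V) (hS : S.Nonempty) (hS2 : S ≠ univ) :
    2 ≤ hh (gg k a) a S := by
  rw [h.hh_eq]
  linarith [h.compl_bound S hS hS2]

lemma Setup.hh_pos (h : Setup k a) (S : Finset V) : -2 ≤ hh (gg k a) a S := by
  by_cases hS : S.Nonempty
  · by_cases hS2 : S = univ
    · rw [h.hh_eq, hS2, card_univ]
      have := h.hE
      have e : E2 a (univ : Finset V)ᶜ = 0 := by simp [E2]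
      rw [e]
      linarith
    · linarith [h.hh_ge S hS hS2]
  · rw [not_nonempty_iff_eq_empty] at hS
    simp [hS, hh]

lemma Setup.dg_le (h : Setup k a) (v : V) : dg a v + 1 ≤ Fintype.card V := by
  unfold dg
  rw [← add_sum_erase univ _ (mem_univ v), h.h0]
  have : ∑ x ∈ univ.erase v, a x v ≤ ∑ x ∈ univ.erase v, 1 := sum_le_sum (fun x _ => h.h1 x v)
  rw [sum_const, smul_eq_mul, mul_one, card_erase_of_mem (mem_univ v), card_univ] at this
  have := h.two_le
  omega

lemma Setup.k_lt (h : Setup k a) : k + 1 ≤ Fintype.card V := by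
  obtain ⟨v⟩ := h.hne
  have := h.dg_le v
  have := h.dg_ge v
  omega

lemma Setup.hdeg (h : Setup k a) (u : V) : ∑ v, a v u + 1 ≤ gg k a u + k := by
  have := h.dg_ge u
  have := h.hk
  unfold gg dg at *
  omega

lemma Setup.sum_dg (h : Setup k a) : ∑ v, dg a v ≤ 2 * k * Fintype.card V := by
  have hE : E2 a univ = ∑ v, (dg a v : ℤ) := by
    unfold E2 dg
    rw [sum_comm]
    push_cast
    rfl
  have hpt : ∀ v ∈ (univ : Finset V), E2 a univ - 2 * (dg a v : ℤ) ≤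
      2 * ((k : ℤ) - 1) * (Fintype.card V - 1) - 4 := by
    intro v _
    have h2 := h.two_le
    have h1 := h.hmin {v}ᶜ (by
      rw [nonempty_iff_ne_empty, Ne, compl_eq_empty_iff]
      intro hcon
      have := congrArg Finset.card hcon
      rw [card_singleton, card_univ] at this
      omega) (by
      rw [Ne, compl_eq_univ_iff]; exact singleton_ne_empty _)
    have h3 := E2_compl a h.hs {v}
    simp only [E2, sum_singleton, h.h0] at h3
    rw [card_compl, card_singleton] at h1
    push_cast [Nat.cast_sub (show 1 ≤ Fintype.card V by omega)] at h1 h3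
    unfold E2 at h1 ⊢
    linarith
  have hs := sum_le_sum hpt
  rw [sum_sub_distrib, sum_const, sum_const, ← mul_sum, ← hE, card_univ, nsmul_eq_mul,
    nsmul_eq_mul] at hs
  have hkn := h.k_lt
  have hk := h.hk
  have hkn' : (k : ℤ) + 1 ≤ Fintype.card V := by exact_mod_cast hkn
  have hk' : (3 : ℤ) ≤ k := by exact_mod_cast hk
  have key : E2 a univ ≤ 2 * k * Fintype.card V := by
    generalize (Fintype.card V : ℤ) = n at *
    generalize E2 a univ = E at *
    have hpos : 0 < n - 2 := by linarith
    have : (n - 2) * E ≤ (n - 2) * (2 * k * n) := by nlinarith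
    exact le_of_mul_le_mul_left this hpos
  rw [hE] at key
  exact_mod_cast key

lemma Setup.small (h : Setup k a) :
    Fintype.card V ≤ 2 * (univ.filter (fun v => dg a v ≤ 4 * k - 1)).card := by
  have h1 := h.sum_dg
  have hk := h.hk
  have h2 : (univ.filter (fun v => ¬ dg a v ≤ 4 * k - 1)).card * (4 * k) ≤ ∑ v, dg a v := by
    rw [← smul_eq_mul]
    refine (card_nsmul_le_sum (univ.filter (fun v => ¬ dg a v ≤ 4 * k - 1)) (dg a) (4 * k) ?_).trans
      (sum_le_sum_of_subset (filter_subset _ _))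
    intro x hx
    have := (mem_filter.1 hx).2
    omega
  have h3 := card_filter_add_card_filter_not (s := (univ : Finset V)) (fun v => dg a v ≤ 4 * k - 1)
  rw [card_univ] at h3
  have h4 : (2 * k) * (2 * (univ.filter (fun v => ¬ dg a v ≤ 4 * k - 1)).card) ≤
      (2 * k) * Fintype.card V := by
    calc _ = (univ.filter (fun v => ¬ dg a v ≤ 4 * k - 1)).card * (4 * k) := by ring
      _ ≤ _ := h2.trans h1
  have h5 := Nat.le_of_mul_le_mul_left h4 (by omega)
  omega

lemma Setup.caseB (h : Setup k a)
    (hZ : 500 * k * (univ.filter (fun v => dg a v = k)).card < Fintype.card V) :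
    ∃ U : Finset V, Cl (gg k a) a U ∧ U ≠ univ ∧ Fintype.card V ≤ 10 ^ 4 * k ^ 2 * U.card := by
  have hk := h.hk
  obtain ⟨Z, hZd⟩ : ∃ Z, Z = univ.filter (fun v => dg a v = k) := ⟨_, rfl⟩
  rw [← hZd] at hZ
  obtain ⟨D, hDd⟩ : ∃ D, D = univ.filter (fun v => dg a v ≤ 4 * k - 1) := ⟨_, rfl⟩
  have hD := h.small
  rw [← hDd] at hD
  obtain ⟨L, hLd⟩ : ∃ L, L = D.filter (fun v => ∀ z ∈ Z, a v z = 0) := ⟨_, rfl⟩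
  have hbad : (D.filter (fun v => ¬ ∀ z ∈ Z, a v z = 0)).card ≤ k * Z.card := by
    have h1 : (D.filter (fun v => ¬ ∀ z ∈ Z, a v z = 0)) ⊆
        Z.biUnion (fun z => univ.filter (fun v => 0 < a v z)) := by
      intro v hv
      have := (mem_filter.1 hv).2
      push Not at this
      obtain ⟨z, hz, hvz⟩ := this
      exact mem_biUnion.2 ⟨z, hz, mem_filter.2 ⟨mem_univ _, Nat.pos_of_ne_zero hvz⟩⟩
    refine (card_le_card h1).trans ?_
    rw [mul_comm]
    apply card_biUnion_le_card_mul
    intro z hz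
    have hz' : dg a z = k := by rw [hZd] at hz; exact (mem_filter.1 hz).2
    rw [← hz', card_filter]
    unfold dg
    apply sum_le_sum
    intro v _
    split_ifs <;> omega
  have hLc : L.card + (D.filter (fun v => ¬ ∀ z ∈ Z, a v z = 0)).card = D.card := by
    rw [hLd]; exact card_filter_add_card_filter_not _
  have hkn := h.k_lt
  have hZ' : 500 * (k * Z.card) < Fintype.card V := by rw [← mul_assoc]; exact hZ
  have hL2 : 2 ≤ L.card := by omega
  obtain ⟨x0, hx0⟩ : L.Nonempty := card_pos.1 (by omega)
  have hLF : ∀ x ∈ L, gg k a x ≤ 3 * k := by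
    intro x hx
    rw [hLd, hDd] at hx
    have := (mem_filter.1 (mem_filter.1 hx).1).2
    unfold gg
    omega
  obtain ⟨U, hU, hxU, hUc⟩ := colour (gg k a) a h.hs h.h0 k (3 * k) (by omega) (by omega)
    h.gg_pos (fun u _ => h.hdeg u) h.hh_pos (fun _ => 1) x0 (hLF x0 hx0) (L.erase x0)
    (notMem_erase _ _) (by
      intro x hx u hux
      have hxL := mem_of_mem_erase hx
      rw [hLd] at hxL
      have hxz := (mem_filter.1 hxL).2
      have h1 := h.h1 x u
      have h2 := h.gg_pos u
      by_cases huZ : u ∈ Z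
      · rw [hxz u huZ]; exact h2
      · have : dg a u ≠ k := by
          intro hc
          apply huZ
          rw [hZd]
          exact mem_filter.2 ⟨mem_univ _, hc⟩
        have := h.dg_ge u
        unfold gg
        omega) (fun x hx => hLF x (mem_of_mem_erase hx))
  refine ⟨U, hU, fun hc => hxU (hc ▸ mem_univ _), ?_⟩
  simp only [sum_const, smul_eq_mul, mul_one] at hUc
  rw [card_erase_of_mem hx0] at hUc
  have e1 : Fintype.card V ≤ 5 * (L.card - 1) := by omega
  calc Fintype.card V ≤ 5 * (L.card - 1) := e1
    _ ≤ 5 * (8 * (k + 1) * (3 * k) * U.card) := Nat.mul_le_mul_left _ hUc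
    _ ≤ 5 * (8 * (2 * k) * (3 * k) * U.card) := by gcongr; omega
    _ ≤ 10 ^ 4 * k ^ 2 * U.card := by
      have : 5 * (8 * (2 * k) * (3 * k) * U.card) = 240 * (k ^ 2 * U.card) := by ring
      rw [this, mul_assoc]
      exact Nat.mul_le_mul_right _ (by norm_num)

end setup

section caseA

variable {V : Type*} [Fintype V] [DecidableEq V]

/-- tight sets -/
def Tight (k : ℕ) (a : V → V → ℕ) (S : Finset V) : Prop :=
  S.Nonempty ∧ hh (gg k a) a S ≤ 2 ∧ 3 ≤ Sᶜ.card

/-- maximal tight sets -/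
def MaxT (k : ℕ) (a : V → V → ℕ) (S : Finset V) : Prop :=
  Tight k a S ∧ ∀ T, Tight k a T → S ⊆ T → T = S

variable {k : ℕ} {a : V → V → ℕ}

lemma Tight.ne_univ {S : Finset V} (hS : Tight k a S) : S ≠ univ := by
  intro h
  have := hS.2.2
  rw [h] at this
  simp at this

lemma Tight.exists_max {S : Finset V} (hS : Tight k a S) : ∃ T, MaxT k a T ∧ S ⊆ T := by
  classical
  obtain ⟨T, hT, hmax⟩ := exists_max_image
    ((univ : Finset (Finset V)).filter (fun T => Tight k a T ∧ S ⊆ T)) card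
    ⟨S, by simp [hS]⟩
  simp only [mem_filter, mem_univ, true_and] at hT hmax
  refine ⟨T, ⟨hT.1, ?_⟩, hT.2⟩
  intro T' hT' hsub
  exact (eq_of_subset_of_card_le hsub (hmax T' ⟨hT', hT.2.trans hsub⟩)).symm

lemma Setup.two_compl (h : Setup k a) (S : Finset V) (hS : Sᶜ.card = 2) :
    4 ≤ hh (gg k a) a S := by
  rw [h.hh_eq]
  have hE := h.hE
  have h1 : E2 a Sᶜ ≤ 2 := by
    obtain ⟨x, y, hxy, hS'⟩ := card_eq_two.1 hS
    rw [hS']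
    have e1 := h.h1 x y
    have e2 := h.h1 y x
    have : E2 a {x, y} = a x y + a y x := by
      simp only [E2, sum_pair hxy, h.h0]
      push_cast
      ring
    rw [this]
    have : (a x y : ℤ) ≤ 1 := by exact_mod_cast e1
    have : (a y x : ℤ) ≤ 1 := by exact_mod_cast e2
    linarith
  have hc : (S.card : ℤ) = Fintype.card V - 2 := by
    have := card_add_card_compl S
    omega
  rw [hc]
  have hk : (3 : ℤ) ≤ k := by exact_mod_cast h.hk
  have : 2 * ((k : ℤ) - 1) * (Fintype.card V - 2) =
    2 * ((k : ℤ) - 1) * Fintype.card V - 4 * ((k : ℤ) - 1) := by ring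
  linarith

lemma Setup.maxT_cl (h : Setup k a) {S : Finset V} (hS : MaxT k a S) : Cl (gg k a) a S := by
  intro u hu
  by_contra hcon
  push Not at hcon
  have e1 := hh_insert (gg k a) a h.hs h.h0 S u hu
  have e2 : (gg k a u : ℤ) ≤ ∑ v ∈ S, (a v u : ℤ) := by exact_mod_cast hcon
  have e3 := hS.1.2.1
  have e4 := hS.1.2.2
  have c1 := card_add_card_compl S
  have c2 := card_add_card_compl (insert u S)
  rw [card_insert_of_notMem hu] at c2
  by_cases h2 : (insert u S)ᶜ.card = 2
  · have := h.two_compl _ h2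
    linarith
  · have := hS.2 (insert u S) ⟨insert_nonempty _ _, by linarith, by omega⟩ (subset_insert _ _)
    exact hu (this ▸ mem_insert_self _ _)


lemma Setup.maxT_disj (h : Setup k a)
    (hno : ∀ U, Cl (gg k a) a U → U ≠ univ → 10 ^ 4 * k ^ 2 * U.card < Fintype.card V)
    {S T : Finset V} (hS : MaxT k a S) (hT : MaxT k a T)
    (hST : S ≠ T) : Disjoint S T ∧ ∑ u ∈ S, ∑ v ∈ T, a v u = 0 := by
  have hk := h.hk
  have c1 := hno S (h.maxT_cl hS) hS.1.ne_univ
  have c2 := hno T (h.maxT_cl hT) hT.1.ne_univ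
  have hSp : 1 ≤ S.card := card_pos.2 hS.1.1
  have c3 : 10 ^ 4 * S.card ≤ 10 ^ 4 * k ^ 2 * S.card := by
    apply Nat.mul_le_mul_right
    nlinarith
  have c4 : 10 ^ 4 * T.card ≤ 10 ^ 4 * k ^ 2 * T.card := by
    apply Nat.mul_le_mul_right
    nlinarith
  have c5 := card_union_le S T
  have c6 := card_add_card_compl (S ∪ T)
  have c7 : 3 ≤ (S ∪ T)ᶜ.card := by omega
  have hnt : ¬ hh (gg k a) a (S ∪ T) ≤ 2 := by
    intro hle
    have ht : Tight k a (S ∪ T) := ⟨hS.1.1.mono subset_union_left, hle, c7⟩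
    have e1 := hS.2 _ ht subset_union_left
    have e2 := hT.2 _ ht subset_union_right
    exact hST (e1.symm.trans e2)
  have hd : Disjoint S T := by
    by_contra hd
    rw [disjoint_iff_inter_eq_empty, ← Ne, ← nonempty_iff_ne_empty] at hd
    have e1 := h.hh_ge (S ∩ T) hd (by
      intro hc
      apply hS.1.ne_univ
      rw [eq_univ_iff_forall] at hc ⊢
      exact fun x => (mem_inter.1 (hc x)).1)
    have e2 := hh_submod (gg k a) a h.hs S T
    apply hnt
    linarith [hS.1.2.1, hT.1.2.1]
  refine ⟨hd, ?_⟩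
  by_contra hne
  have e1 := hh_union (gg k a) a h.hs S T hd
  have e2 : (1 : ℤ) ≤ ∑ u ∈ S, ∑ v ∈ T, (a v u : ℤ) := by
    exact_mod_cast Nat.one_le_iff_ne_zero.2 hne
  apply hnt
  linarith [hS.1.2.1, hT.1.2.1]

open Classical in
/-- the block of a vertex -/
noncomputable def bl (k : ℕ) (a : V → V → ℕ) (v : V) : Finset V :=
  if hv : ∃ S, MaxT k a S ∧ v ∈ S then hv.choose else {v}

lemma mem_bl (v : V) : v ∈ bl k a v := by
  unfold bl
  split_ifs with hv
  · exact hv.choose_spec.2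
  · exact mem_singleton_self _

lemma bl_cases (v : V) :
    MaxT k a (bl k a v) ∨ (bl k a v = {v} ∧ ∀ S, MaxT k a S → v ∉ S) := by
  by_cases hv : ∃ S, MaxT k a S ∧ v ∈ S
  · left
    unfold bl
    rw [dif_pos hv]
    exact hv.choose_spec.1
  · right
    refine ⟨by unfold bl; rw [dif_neg hv], ?_⟩
    intro S hS hvS
    exact hv ⟨S, hS, hvS⟩

lemma Setup.bl_eq (h : Setup k a)
    (hno : ∀ U, Cl (gg k a) a U → U ≠ univ → 10 ^ 4 * k ^ 2 * U.card < Fintype.card V)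
    {S : Finset V} (hS : MaxT k a S) {v : V} (hv : v ∈ S) : bl k a v = S := by
  rcases bl_cases (k := k) (a := a) v with hm | ⟨_, hn⟩
  · by_contra hne
    exact disjoint_left.1 (h.maxT_disj hno hm hS hne).1 (mem_bl v) hv
  · exact (hn S hS hv).elim

lemma Setup.mem_bl_iff (h : Setup k a)
    (hno : ∀ U, Cl (gg k a) a U → U ≠ univ → 10 ^ 4 * k ^ 2 * U.card < Fintype.card V)
    (u v : V) : bl k a u = bl k a v ↔ u ∈ bl k a v := by
  constructor
  · intro he
    rw [← he]; exact mem_bl u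
  · intro hu
    rcases bl_cases (k := k) (a := a) v with hm | ⟨he, _⟩
    · exact h.bl_eq hno hm hu
    · rw [he, mem_singleton] at hu
      rw [hu]

lemma Setup.caseA (h : Setup k a)
    (hZ : Fintype.card V ≤ 500 * k * (univ.filter (fun v => dg a v = k)).card) :
    ∃ U : Finset V, Cl (gg k a) a U ∧ U ≠ univ ∧ Fintype.card V ≤ 10 ^ 4 * k ^ 2 * U.card := by
  classical
  by_contra hcon
  have hno : ∀ U, Cl (gg k a) a U → U ≠ univ → 10 ^ 4 * k ^ 2 * U.card < Fintype.card V := by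
    intro U h1 h2
    by_contra h3
    exact hcon ⟨U, h1, h2, not_lt.1 h3⟩
  have hk := h.hk
  have hkn := h.k_lt
  have hhs : ∀ v, hh (gg k a) a {v} = 2 * gg k a v := by
    intro v; simp [hh, h.h0]
  obtain ⟨Z, hZd⟩ : ∃ Z, Z = univ.filter (fun v => dg a v = k) := ⟨_, rfl⟩
  rw [← hZd] at hZ
  have hZt : ∀ z ∈ Z, MaxT k a (bl k a z) := by
    intro z hz
    have ht : Tight k a {z} := by
      refine ⟨singleton_nonempty _, ?_, ?_⟩
      · rw [hhs, h.gg_cast]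
        rw [hZd] at hz
        rw [(mem_filter.1 hz).2]
        ring_nf; rfl
      · rw [card_compl, card_singleton]; omega
    obtain ⟨T, hT, hzT⟩ := ht.exists_max
    rw [h.bl_eq hno hT (hzT (mem_singleton_self _))]
    exact hT
  have hZne : Z.Nonempty := by
    rw [← card_pos]
    rcases Nat.eq_zero_or_pos Z.card with h0 | h0
    · rw [h0] at hZ; omega
    · exact h0
  obtain ⟨z0, hz0⟩ := hZne
  let W := {p : Finset V // p ∈ (univ : Finset V).image (bl k a)}
  let π : V → W := fun v => ⟨bl k a v, mem_image_of_mem _ (mem_univ v)⟩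
  have hpre : ∀ p : W, pre π {p} = p.1 := by
    rintro ⟨p, hp⟩
    obtain ⟨u, _, rfl⟩ := mem_image.1 hp
    ext v
    simp only [pre, mem_filter, mem_univ, true_and, mem_singleton, π]
    exact Subtype.ext_iff.trans (h.mem_bl_iff hno v u)
  have hcases : ∀ p : W, (MaxT k a p.1 ∧ hh (gg k a) a p.1 = 2) ∨
      ∃ v, p.1 = {v} ∧ ∀ S, MaxT k a S → v ∉ S := by
    rintro ⟨p, hp⟩
    obtain ⟨u, _, rfl⟩ := mem_image.1 hp
    rcases bl_cases (k := k) (a := a) u with hm | hn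
    · left
      exact ⟨hm, le_antisymm hm.1.2.1 (h.hh_ge _ hm.1.1 hm.1.ne_univ)⟩
    · right
      exact ⟨u, hn⟩
  obtain ⟨g', hg'd⟩ : ∃ g' : W → ℕ, ∀ p, 2 * (g' p : ℤ) = hh (gg k a) a p.1 := by
    have : ∀ p : W, ∃ x : ℕ, 2 * (x : ℤ) = hh (gg k a) a p.1 := by
      intro p
      rcases hcases p with hm | ⟨v, hv, _⟩
      · exact ⟨1, by rw [hm.2]; norm_num⟩
      · exact ⟨gg k a v, by rw [hv, hhs]⟩
    choose f hf using this
    exact ⟨f, hf⟩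
  have hg'1 : ∀ p : W, MaxT k a p.1 → g' p = 1 := by
    intro p hp
    have e1 := hg'd p
    have e2 := le_antisymm hp.1.2.1 (h.hh_ge _ hp.1.1 hp.1.ne_univ)
    rw [e2] at e1
    omega
  have hg's : ∀ (p : W) v, p.1 = {v} → g' p = gg k a v := by
    intro p v hp
    have e1 := hg'd p
    rw [hp, hhs] at e1
    omega
  have hhc := hh_contract (gg k a) a h.hs π g' (fun p => by rw [hpre, hg'd])
  have hdeg' : ∀ p : W, 2 ≤ g' p → ∑ q, mc a π q p + 1 ≤ g' p + k := by
    intro p hp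
    rcases hcases p with hm | ⟨v, hv, _⟩
    · rw [hg'1 p hm.1] at hp; omega
    · rw [hg's p v hv]
      refine le_trans ?_ (h.hdeg v)
      rw [← add_sum_erase univ _ (mem_univ p)]
      have e0 : mc a π p p = 0 := by simp [mc]
      rw [e0, mc_sum a π _ p (notMem_erase _ _), hpre, hv, sum_singleton]
      have : ∑ x ∈ pre π (univ.erase p), a x v ≤ ∑ x, a x v :=
        sum_le_sum_of_subset (subset_univ _)
      omega
  have hgpos' : ∀ p, 0 < g' p := by
    intro p
    rcases hcases p with hm | ⟨v, hv, _⟩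
    · rw [hg'1 p hm.1]; omega
    · rw [hg's p v hv]; exact h.gg_pos v
  obtain ⟨X, hX⟩ : ∃ X : Finset W, X = univ.filter (fun p => MaxT k a p.1) := ⟨_, rfl⟩
  have hXm : ∀ p, p ∈ X ↔ MaxT k a p.1 := by intro p; rw [hX]; simp
  have hseed : ∀ x ∈ X, ∀ u, u ≠ x → mc a π x u < g' u := by
    intro x hx u hux
    rw [hXm] at hx
    rcases hcases u with hm | ⟨v, hv, hvn⟩
    · rw [hg'1 u hm.1]
      unfold mc
      rw [if_neg (Ne.symm hux), hpre, hpre]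
      have hne : u.1 ≠ x.1 := fun hc => hux (Subtype.ext hc)
      have := (h.maxT_disj hno hm.1 hx hne).2
      rw [sum_comm, this]
      exact Nat.one_pos
    · rw [hg's u v hv]
      unfold mc
      rw [if_neg (Ne.symm hux), hpre, hpre, hv]
      simp only [sum_singleton]
      exact h.maxT_cl hx v (hvn _ hx)
  have hx0 : π z0 ∈ X := (hXm _).2 (hZt z0 hz0)
  obtain ⟨U, hU, hxU, hUc⟩ := colour g' (mc a π) (mc_symm a h.hs π) (by simp [mc]) k 1 (by omega)
    le_rfl hgpos' hdeg' (fun S => by rw [hhc]; exact h.hh_pos _) (fun p => p.1.card) (π z0)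
    (by rw [hg'1 _ ((hXm _).1 hx0)]) (X.erase (π z0)) (notMem_erase _ _)
    (fun x hx => hseed x (mem_of_mem_erase hx))
    (fun x hx => by rw [hg'1 _ ((hXm _).1 (mem_of_mem_erase hx))])
  have hcardU : ∑ p ∈ U, p.1.card = (pre π U).card := by
    have := pre_sum π U (fun _ => 1)
    rw [card_eq_sum_ones, this]
    apply sum_congr rfl
    intro p _
    rw [hpre, card_eq_sum_ones]
  have hUcl : Cl (gg k a) a (pre π U) := by
    intro u hu
    have hp : π u ∉ U := by
      intro hc; exact hu (mem_filter.2 ⟨mem_univ _, hc⟩)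
    have e1 := hU (π u) hp
    rw [mc_sum a π U _ hp, hpre] at e1
    have e2 : ∑ v ∈ pre π U, a v u ≤ ∑ w ∈ (π u).1, ∑ v ∈ pre π U, a v w :=
      single_le_sum (f := fun w => ∑ v ∈ pre π U, a v w) (fun _ _ => Nat.zero_le _) (mem_bl u)
    have e3 : g' (π u) ≤ gg k a u := by
      rcases hcases (π u) with hm | ⟨v, hv, _⟩
      · rw [hg'1 _ hm.1]; exact h.gg_pos u
      · rw [hg's _ v hv]
        have : u ∈ (π u).1 := mem_bl u
        rw [hv, mem_singleton] at this
        rw [this]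
    omega
  have hUne : pre π U ≠ univ := by
    intro hc
    have : z0 ∈ pre π U := by rw [hc]; exact mem_univ _
    exact hxU (mem_filter.1 this).2
  have f1 := hno _ hUcl hUne
  have f2 := hno _ (h.maxT_cl (hZt z0 hz0)) (hZt z0 hz0).1.ne_univ
  have f3 : Z.card ≤ (bl k a z0).card + ∑ p ∈ X.erase (π z0), p.1.card := by
    have e1 : ∑ p ∈ X, p.1.card = (bl k a z0).card + ∑ p ∈ X.erase (π z0), p.1.card :=
      (add_sum_erase X (fun p => p.1.card) hx0).symm
    rw [← e1]
    have hsub : Z ⊆ X.biUnion (fun p => p.1) := by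
      intro z hz
      exact mem_biUnion.2 ⟨π z, (hXm _).2 (hZt z hz), mem_bl z⟩
    exact (card_le_card hsub).trans card_biUnion_le
  rw [hcardU] at hUc
  generalize (pre π U).card = x at *
  generalize (bl k a z0).card = y at *
  generalize ∑ p ∈ X.erase (π z0), p.1.card = s at *
  generalize Fintype.card V = n at *
  generalize Z.card = z at *
  have g1 : n ≤ 500 * k * (y + 8 * (k + 1) * x) := by
    refine hZ.trans (Nat.mul_le_mul_left _ ?_)
    rw [mul_one] at hUc
    omega
  have g2 : 500 * k * (y + 8 * (k + 1) * x) ≤ 500 * (k * k * y) + 6000 * (k * k * x) := by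
    have e1 : k * y ≤ k * k * y := Nat.mul_le_mul_right _ (Nat.le_mul_of_pos_left _ (by omega))
    have e2 : k * (k + 1) * x * 3 ≤ k * k * x * 4 := by
      have : (k + 1) * 3 ≤ k * 4 := by omega
      calc k * (k + 1) * x * 3 = k * x * ((k + 1) * 3) := by ring
        _ ≤ k * x * (k * 4) := Nat.mul_le_mul_left _ this
        _ = _ := by ring
    have e3 : 500 * k * (y + 8 * (k + 1) * x) = 500 * (k * y) + 4000 * (k * (k + 1) * x) := by ring
    rw [e3]
    omega
  have g3 : 10 ^ 4 * k ^ 2 * x = 10000 * (k * k * x) := by ring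
  have g4 : 10 ^ 4 * k ^ 2 * y = 10000 * (k * k * y) := by ring
  omega

lemma Setup.main (h : Setup k a) :
    ∃ U : Finset V, Cl (gg k a) a U ∧ U ≠ univ ∧ Fintype.card V ≤ 10 ^ 4 * k ^ 2 * U.card := by
  rcases lt_or_ge (500 * k * (univ.filter (fun v => dg a v = k)).card) (Fintype.card V) with hZ | hZ
  · exact h.caseB hZ
  · exact h.caseA hZ

end caseA

lemma final {V : Type*} [Fintype V] [DecidableEq V] (k : ℕ) (hk : 3 ≤ k) (a : V → V → ℕ)
    (hs : ∀ u v, a u v = a v u) (h0 : ∀ u, a u u = 0) (h1 : ∀ u v, a u v ≤ 1)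
    (hne : Nonempty V) (hE : 2 * ((k : ℤ) - 1) * Fintype.card V - 2 ≤ E2 a univ) :
    ∃ (A s : Finset V), s ⊆ A ∧ s.Nonempty ∧ A.card ≤ 10 ^ 4 * k ^ 2 * (A.card - s.card) ∧
      ∀ v ∈ s, k ≤ ∑ u ∈ s, a u v := by
  classical
  obtain ⟨A, hA, hAmin⟩ := exists_min_image ((univ : Finset (Finset V)).filter
    (fun A => A.Nonempty ∧ 2 * ((k : ℤ) - 1) * A.card - 2 ≤ E2 a A)) card
    ⟨univ, by
      simp only [mem_filter, mem_univ, true_and, card_univ]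
      exact ⟨univ_nonempty, hE⟩⟩
  simp only [mem_filter, mem_univ, true_and] at hA hAmin
  obtain ⟨hAne, hAE⟩ := hA
  let emb : {x // x ∈ A} ↪ V := Function.Embedding.subtype _
  let a' : {x // x ∈ A} → {x // x ∈ A} → ℕ := fun u v => a u.1 v.1
  have hE2 : ∀ S : Finset {x // x ∈ A}, E2 a' S = E2 a (S.map emb) := by
    intro S
    simp only [E2, sum_map, emb, a']
    rfl
  have hmapA : (univ : Finset {x // x ∈ A}).map emb = A := by
    ext x; simp [emb]
  have hset : Setup k a' := by
    refine ⟨hk, fun u v => hs _ _, fun u => h0 _, fun u v => h1 _ _, ?_, ?_, ?_⟩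
    · obtain ⟨x, hx⟩ := hAne
      exact ⟨⟨x, hx⟩⟩
    · rw [hE2, hmapA, Fintype.card_coe]
      exact hAE
    · intro S hSne hSu
      by_contra hcon
      push Not at hcon
      obtain ⟨e, he⟩ := E2_even a' (fun u v => hs _ _) (fun u => h0 _) S
      have hge : 2 * ((k : ℤ) - 1) * S.card - 2 ≤ E2 a' S := by
        rw [he] at hcon ⊢
        have : 2 * ((k : ℤ) - 1) * S.card = 2 * (((k : ℤ) - 1) * S.card) := by ring
        rw [this] at hcon ⊢
        omega
      have := hAmin (S.map emb) ⟨hSne.map, by rw [card_map, ← hE2]; exact hge⟩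
      rw [card_map] at this
      apply hSu
      rw [← card_eq_iff_eq_univ, Fintype.card_coe]
      refine le_antisymm ?_ this
      have := card_le_univ S
      rwa [Fintype.card_coe] at this
  obtain ⟨U, hU, hUne, hUc⟩ := hset.main
  have hcc := card_add_card_compl U
  rw [Fintype.card_coe] at hUc hcc
  refine ⟨A, Uᶜ.map emb, ?_, ?_, ?_, ?_⟩
  · intro x hx
    obtain ⟨y, _, rfl⟩ := mem_map.1 hx
    exact y.2
  · rw [map_nonempty, nonempty_iff_ne_empty, Ne, compl_eq_empty_iff]
    exact hUne
  · rw [card_map]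
    have : A.card - Uᶜ.card = U.card := by omega
    rw [this]; exact hUc
  · intro v hv
    obtain ⟨y, hy, rfl⟩ := mem_map.1 hv
    have e1 := hU y (mem_compl.1 hy)
    have e2 := hset.dg_ge y
    rw [sum_map]
    have e3 : ∑ x ∈ U, a' x y + ∑ x ∈ Uᶜ, a' x y = dg a' y := sum_add_sum_compl U _
    have e4 : ∑ x ∈ Uᶜ, a (emb x) (emb y) = ∑ x ∈ Uᶜ, a' x y := rfl
    rw [e4]
    unfold gg at e1
    omega

end MinDeg

theorem min_degree_k_subgraph_of_edges_ge_sub_one {V : Type*} [Fintype V] [DecidableEq V]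
    (k n : ℕ) (hk : 3 ≤ k)
    (G : SimpleGraph V) [DecidableRel G.Adj]
    (hn : Fintype.card V = n) (hnk : k - 1 ≤ n)
    (he : (k - 1) * n ≤ G.edgeFinset.card + 1) :
    ∃ s : Finset V, s.Nonempty ∧
      (s.card : ℝ) ≤ (1 - 1 / (10 ^ 4 * (k : ℝ) ^ 2)) * (n : ℝ) ∧
      ∀ v ∈ s, k ≤ (s.filter (fun u => G.Adj v u)).card := by
  have hne : Nonempty V := by
    rw [← Fintype.card_pos_iff, hn]; omega
  have hdeg : MinDeg.E2 (fun u v => if G.Adj u v then 1 else 0) Finset.univ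
      = 2 * (G.edgeFinset.card : ℤ) := by
    have h1 := G.sum_degrees_eq_twice_card_edges
    have h2 : (((∑ v, G.degree v : ℕ)) : ℤ) = 2 * (G.edgeFinset.card : ℤ) := by
      exact_mod_cast h1
    rw [← h2]
    unfold MinDeg.E2
    push_cast
    apply Finset.sum_congr rfl
    intro v _
    rw [← SimpleGraph.card_neighborFinset_eq_degree, SimpleGraph.neighborFinset_eq_filter,
      Finset.card_filter]
    push_cast
    rfl
  obtain ⟨A, s, hsA, hsne, hc, hmin⟩ := MinDeg.final k hk
    (fun u v => if G.Adj u v then 1 else 0) (fun u v => by simp only [G.adj_comm])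
    (fun u => by simp) (fun u v => by split_ifs <;> omega) hne (by
      rw [hdeg, hn]
      have h1 : (((k - 1) * n : ℕ) : ℤ) ≤ G.edgeFinset.card + 1 := by exact_mod_cast he
      push_cast [Nat.cast_sub (show 1 ≤ k by omega)] at h1
      linarith)
  refine ⟨s, hsne, ?_, ?_⟩
  · have hsc : s.card ≤ A.card := Finset.card_le_card hsA
    have hAn : A.card ≤ n := hn ▸ Finset.card_le_univ A
    have hkr : (0 : ℝ) < 10 ^ 4 * (k : ℝ) ^ 2 := by
      have : (0 : ℝ) < k := by exact_mod_cast (show 0 < k by omega)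
      positivity
    have h1 : (A.card : ℝ) ≤ 10 ^ 4 * (k : ℝ) ^ 2 * (A.card - s.card) := by
      have : (A.card : ℝ) ≤ ((10 ^ 4 * k ^ 2 * (A.card - s.card) : ℕ) : ℝ) := by exact_mod_cast hc
      push_cast [Nat.cast_sub hsc] at this
      linarith
    have h2 : (1 / (10 ^ 4 * (k : ℝ) ^ 2)) * A.card ≤ A.card - s.card := by
      rw [one_div, inv_mul_le_iff₀ hkr]
      exact h1
    have h3 : (1 : ℝ) / (10 ^ 4 * (k : ℝ) ^ 2) ≤ 1 := by
      rw [div_le_one hkr]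
      have : (3 : ℝ) ≤ k := by exact_mod_cast hk
      nlinarith
    have h4 : (A.card : ℝ) ≤ n := by exact_mod_cast hAn
    nlinarith
  · intro v hv
    have := hmin v hv
    rw [Finset.card_filter]
    simpa only [G.adj_comm v] using this
end

section
/- Let w be a vertex of H with deg_H(w) ≤ k-1. If Y₁ and Y₂ are both w-closed subsets of V(H), then Y₁ ∩ Y₂ is w-closed. Consequently, since V(H) itself is w-closed, there is a unique minimal w-closed subset of V(H). -/
/-- The number of edges of `H` incident with at least one vertex of `X`. -/
def eBar {V : Type*} [Fintype V] [DecidableEq V] (H : SimpleGraph V) [DecidableRel H.Adj]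
    (X : Finset V) : ℕ :=
  (H.edgeFinset.filter (fun e => ∃ v ∈ X, v ∈ e)).card

/-- A subset `Y ⊆ V(H)` is `w`-closed (with respect to the collection `CH`) if:
(I) `w ∈ Y`; (II) every `D ∈ CH` satisfies `D ⊆ Y` or `D ∩ Y = ∅`; (III) every vertex
outside `Y` adjacent to a vertex of `Y` has degree at least `k` in `H - Y`; (IV) every
`D ∈ CH` adjacent to a vertex of `Y` satisfies `D ⊆ Y`. -/
def WClosed {V : Type*} [Fintype V] [DecidableEq V] (k : ℕ) (H : SimpleGraph V)
    [DecidableRel H.Adj] (CH : Finset (Finset V)) (w : V) (Y : Finset V) : Prop :=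
  w ∈ Y ∧
  (∀ D ∈ CH, D ⊆ Y ∨ D ∩ Y = ∅) ∧
  (∀ v ∉ Y, (∃ y ∈ Y, H.Adj v y) → k ≤ (H.neighborFinset v \ Y).card) ∧
  (∀ D ∈ CH, (∃ d ∈ D, ∃ y ∈ Y, H.Adj d y) → D ⊆ Y)

/-- The intersection of two `w`-closed sets is `w`-closed; consequently there is a unique
minimal `w`-closed subset of `V(H)`. -/
theorem wClosed_inter_and_exists_unique_minimal {V : Type*} [Fintype V] [DecidableEq V]
    (k : ℕ) (hk : 2 ≤ k) (H : SimpleGraph V) [DecidableRel H.Adj]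
    (CH : Finset (Finset V))
    (hCHne : ∀ D ∈ CH, D.Nonempty)
    (hCHdisj : ∀ D₁ ∈ CH, ∀ D₂ ∈ CH, D₁ ≠ D₂ → Disjoint D₁ D₂)
    (hCHe : ∀ D ∈ CH, eBar H D ≤ (k - 1) * D.card + 1)
    (hCHdeg : ∀ D ∈ CH, ∀ v ∈ D, k ≤ H.degree v)
    (w : V) (hw : H.degree w ≤ k - 1) :
    (∀ Y₁ Y₂ : Finset V, WClosed k H CH w Y₁ → WClosed k H CH w Y₂ →
        WClosed k H CH w (Y₁ ∩ Y₂)) ∧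
    (∃! Y : Finset V, WClosed k H CH w Y ∧ ∀ Y' : Finset V, WClosed k H CH w Y' → Y ⊆ Y') := by
  have hinter : ∀ Y₁ Y₂ : Finset V, WClosed k H CH w Y₁ → WClosed k H CH w Y₂ →
      WClosed k H CH w (Y₁ ∩ Y₂) := by
    rintro Y₁ Y₂ ⟨a1, a2, a3, a4⟩ ⟨b1, b2, b3, b4⟩
    refine ⟨Finset.mem_inter.2 ⟨a1, b1⟩, ?_, ?_, ?_⟩
    · intro D hD
      rcases a2 D hD with h1 | h1
      · rcases b2 D hD with h2 | h2
        · exact Or.inl (Finset.subset_inter h1 h2)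
        · right
          rw [← Finset.subset_empty, ← h2]
          exact Finset.inter_subset_inter le_rfl Finset.inter_subset_right
      · right
        rw [← Finset.subset_empty, ← h1]
        exact Finset.inter_subset_inter le_rfl Finset.inter_subset_left
    · rintro v hv ⟨y, hy, hvy⟩
      rw [Finset.mem_inter] at hy
      by_cases h1 : v ∈ Y₁
      · have h2 : v ∉ Y₂ := fun h => hv (Finset.mem_inter.2 ⟨h1, h⟩)
        exact (b3 v h2 ⟨y, hy.2, hvy⟩).trans
          (Finset.card_le_card (Finset.sdiff_subset_sdiff le_rfl Finset.inter_subset_right))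
      · exact (a3 v h1 ⟨y, hy.1, hvy⟩).trans
          (Finset.card_le_card (Finset.sdiff_subset_sdiff le_rfl Finset.inter_subset_left))
    · rintro D hD ⟨d, hd, y, hy, hdy⟩
      rw [Finset.mem_inter] at hy
      exact Finset.subset_inter (a4 D hD ⟨d, hd, y, hy.1, hdy⟩) (b4 D hD ⟨d, hd, y, hy.2, hdy⟩)
  refine ⟨hinter, ?_⟩
  have huniv : WClosed k H CH w Finset.univ :=
    ⟨Finset.mem_univ _, fun D _ => Or.inl (Finset.subset_univ D),
      fun v hv => absurd (Finset.mem_univ v) hv, fun D _ _ => Finset.subset_univ D⟩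
  classical
  obtain ⟨Y, hY, hmin⟩ := Finset.exists_min_image
    (Finset.univ.filter (fun Y : Finset V => WClosed k H CH w Y)) Finset.card
    ⟨Finset.univ, Finset.mem_filter.2 ⟨Finset.mem_univ _, huniv⟩⟩
  have hYc := (Finset.mem_filter.1 hY).2
  have hle : ∀ Y' : Finset V, WClosed k H CH w Y' → Y ⊆ Y' := by
    intro Y' hY'
    have h := hmin (Y ∩ Y') (Finset.mem_filter.2 ⟨Finset.mem_univ _, hinter _ _ hYc hY'⟩)
    exact Finset.inter_eq_left.1 (Finset.eq_of_subset_of_card_le Finset.inter_subset_left h)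
  exact ⟨Y, ⟨hYc, hle⟩, fun Z hZ => Finset.Subset.antisymm (hZ.2 Y hYc) (hle Z hZ.1)⟩
end

section
/- For every vertex w of H with deg_H(w) ≤ k-1, the shadow sh_H(w) satisfies ē_H(sh_H(w)) ≤ (k-1)·|sh_H(w)|. -/
theorem eBar_insert_le {V : Type*} [Fintype V] [DecidableEq V]
    (H : SimpleGraph V) [DecidableRel H.Adj] (Y : Finset V) (v : V) :
    eBar H (insert v Y) ≤ eBar H Y + (H.neighborFinset v \ Y).card := by
  unfold eBar
  refine le_trans (Finset.card_le_card (t := (H.edgeFinset.filter (fun e => ∃ v ∈ Y, v ∈ e)) ∪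
    (H.neighborFinset v \ Y).image (fun u => s(v, u))) ?_) ?_
  · intro e he
    rw [Finset.mem_filter] at he
    obtain ⟨he, x, hx, hxe⟩ := he
    by_cases hY : ∃ v ∈ Y, v ∈ e
    · exact Finset.mem_union_left _ (Finset.mem_filter.2 ⟨he, hY⟩)
    · apply Finset.mem_union_right
      have hxv : x = v := by
        rcases Finset.mem_insert.1 hx with h | h
        · exact h
        · exact absurd ⟨x, h, hxe⟩ hY
      subst hxv
      obtain ⟨u, rfl⟩ := Sym2.mem_iff_exists.1 hxe
      rw [Finset.mem_image]
      refine ⟨u, ?_, rfl⟩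
      rw [Finset.mem_sdiff, SimpleGraph.mem_neighborFinset]
      refine ⟨by simpa using he, fun hu => hY ⟨u, hu, by simp⟩⟩
  · refine (Finset.card_union_le _ _).trans ?_
    exact Nat.add_le_add_left Finset.card_image_le _

theorem eBar_union_lt {V : Type*} [Fintype V] [DecidableEq V]
    (H : SimpleGraph V) [DecidableRel H.Adj] (Y D : Finset V) (y d : V) (hy : y ∈ Y)
    (hd : d ∈ D) (h : H.Adj d y) :
    eBar H (Y ∪ D) + 1 ≤ eBar H Y + eBar H D := by
  unfold eBar
  rw [← Finset.card_union_add_card_inter]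
  apply Nat.add_le_add
  · apply Finset.card_le_card
    intro e he
    simp only [Finset.mem_filter, Finset.mem_union] at he ⊢
    obtain ⟨he, x, hx | hx, hxe⟩ := he
    · exact Or.inl ⟨he, x, hx, hxe⟩
    · exact Or.inr ⟨he, x, hx, hxe⟩
  · apply Finset.card_pos.2
    refine ⟨s(d, y), ?_⟩
    simp only [Finset.mem_inter, Finset.mem_filter]
    have he : s(d, y) ∈ H.edgeFinset := by simpa using h
    exact ⟨⟨he, y, hy, by simp⟩, ⟨he, d, hd, by simp⟩⟩

/-- The shadow `sh_H(w)` (the minimal `w`-closed set) satisfies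
`ē_H(sh_H(w)) ≤ (k-1)·|sh_H(w)|`. -/
theorem eBar_shadow_le {V : Type*} [Fintype V] [DecidableEq V]
    (k : ℕ) (hk : 2 ≤ k) (H : SimpleGraph V) [DecidableRel H.Adj]
    (CH : Finset (Finset V))
    (hCHne : ∀ D ∈ CH, D.Nonempty)
    (hCHdisj : ∀ D₁ ∈ CH, ∀ D₂ ∈ CH, D₁ ≠ D₂ → Disjoint D₁ D₂)
    (hCHe : ∀ D ∈ CH, eBar H D ≤ (k - 1) * D.card + 1)
    (hCHdeg : ∀ D ∈ CH, ∀ v ∈ D, k ≤ H.degree v)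
    (w : V) (hw : H.degree w ≤ k - 1)
    (Sh : Finset V) (hSh : WClosed k H CH w Sh)
    (hShMin : ∀ Y : Finset V, WClosed k H CH w Y → Sh ⊆ Y) :
    eBar H Sh ≤ (k - 1) * Sh.card := by
  classical
  obtain ⟨hS1, hS2, hS3, hS4⟩ := hSh
  let P : Finset V → Prop := fun Y => w ∈ Y ∧ (∀ D ∈ CH, D ⊆ Y ∨ D ∩ Y = ∅) ∧
    eBar H Y ≤ (k - 1) * Y.card
  have hPw : {w} ∈ Sh.powerset.filter P := by
    rw [Finset.mem_filter, Finset.mem_powerset]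
    refine ⟨by simpa using hS1, by simp, ?_, ?_⟩
    · intro D hD
      right
      rw [Finset.inter_singleton_of_notMem]
      intro hwD
      have := hCHdeg D hD w hwD
      omega
    · have h := eBar_insert_le H ∅ w
      have h0 : eBar H (∅ : Finset V) = 0 := by simp [eBar]
      rw [h0] at h
      simp only [Finset.sdiff_empty, SimpleGraph.card_neighborFinset_eq_degree] at h
      simp only [Finset.card_singleton, mul_one]
      have h' : eBar H {w} ≤ 0 + H.degree w := h
      omega
  obtain ⟨Y, hYm, hmax⟩ := Finset.exists_max_image (Sh.powerset.filter P) Finset.card ⟨_, hPw⟩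
  rw [Finset.mem_filter, Finset.mem_powerset] at hYm
  obtain ⟨hYS, hwY, hYD, hYe⟩ := hYm
  have h4 : ∀ D ∈ CH, (∃ d ∈ D, ∃ y ∈ Y, H.Adj d y) → D ⊆ Y := by
    rintro D hD ⟨d, hd, y, hy, hdy⟩
    rcases hYD D hD with h | h
    · exact h
    exfalso
    have hdis : Disjoint Y D := (Finset.disjoint_iff_inter_eq_empty.2 h).symm
    have hDS : D ⊆ Sh := hS4 D hD ⟨d, hd, y, hYS hy, hdy⟩
    have hc : (Y ∪ D).card = Y.card + D.card := Finset.card_union_of_disjoint hdis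
    have hDpos : 0 < D.card := (hCHne D hD).card_pos
    have := hmax (Y ∪ D) (by
      rw [Finset.mem_filter, Finset.mem_powerset]
      refine ⟨Finset.union_subset hYS hDS, Finset.mem_union_left _ hwY, ?_, ?_⟩
      · intro D' hD'
        by_cases hDD : D' = D
        · subst hDD
          exact Or.inl Finset.subset_union_right
        · rcases hYD D' hD' with h' | h'
          · exact Or.inl (h'.trans Finset.subset_union_left)
          · right
            rw [Finset.inter_union_distrib_left, h',
              Finset.disjoint_iff_inter_eq_empty.1 (hCHdisj D' hD' D hD hDD), Finset.union_empty]
      · have h1 := eBar_union_lt H Y D y d hy hd hdy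
        have h2 := hCHe D hD
        rw [hc, mul_add]
        omega)
    omega
  refine le_trans (le_of_eq ?_) hYe |>.trans (Nat.mul_le_mul_left _ (Finset.card_le_card hYS))
  congr 1
  refine Finset.Subset.antisymm (hShMin Y ⟨hwY, hYD, ?_, h4⟩) hYS
  rintro v hv ⟨y, hy, hvy⟩
  by_contra hlt
  have hvS : v ∈ Sh := by
    by_contra hvS
    apply hlt
    exact (hS3 v hvS ⟨y, hYS hy, hvy⟩).trans
      (Finset.card_le_card (Finset.sdiff_subset_sdiff (Finset.Subset.refl _) hYS))
  have hc : (insert v Y).card = Y.card + 1 := Finset.card_insert_of_notMem hv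
  have := hmax (insert v Y) (by
    rw [Finset.mem_filter, Finset.mem_powerset]
    refine ⟨Finset.insert_subset hvS hYS, Finset.mem_insert_of_mem hwY, ?_, ?_⟩
    · intro D hD
      rcases hYD D hD with h | h
      · exact Or.inl (h.trans (Finset.subset_insert _ _))
      · right
        rw [Finset.inter_insert_of_notMem, h]
        intro hvD
        exact hv (h4 D hD ⟨v, hvD, y, hy, hvy⟩ hvD)
    · have h1 := eBar_insert_le H Y v
      rw [hc, mul_add, mul_one]
      omega)
  omega
end

section
/- Let H̃ be a finite simple graph containing H as a proper induced subgraph, such that no vertex of V(H̃)\V(H) is adjacent to any member of C_H. Let w ∈ V(H) be a vertex with deg_{H̃}(w) ≤ k-1, and suppose that ē_H(sh_H(w)) = (k-1)·|sh_H(w)|. Then sh_{H̃}(w) ⊆ sh_H(w), and no vertex of V(H̃)\V(H) is adjacent to any vertex of sh_{H̃}(w). Here sh_{H̃}(w) denotes the unique minimal w-closed subset of V(H̃), where w-closedness in H̃ is defined with respect to the same collection C_H. -/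
/-- The number of edges of the subgraph of `Ht` induced on the vertex set `A` that are
incident with at least one vertex of `X`. -/
def eBarIn {V : Type*} [Fintype V] [DecidableEq V] (Ht : SimpleGraph V) [DecidableRel Ht.Adj]
    (A X : Finset V) : ℕ :=
  (Ht.edgeFinset.filter (fun e => (∀ v ∈ e, v ∈ A) ∧ ∃ v ∈ X, v ∈ e)).card

/-- `Y` is a `w`-closed subset of the vertex set `A` (in the subgraph of `Ht` induced on `A`,
with respect to the collection `CH`): (I) `w ∈ Y`; (II) every `D ∈ CH` satisfies `D ⊆ Y` or
`D ∩ Y = ∅`; (III) every vertex of `A` outside `Y` adjacent to a vertex of `Y` has degree at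
least `k` in the induced graph minus `Y`; (IV) every `D ∈ CH` adjacent to a vertex of `Y`
satisfies `D ⊆ Y`. -/
def WClosedIn {V : Type*} [Fintype V] [DecidableEq V] (k : ℕ) (Ht : SimpleGraph V)
    [DecidableRel Ht.Adj] (A : Finset V) (CH : Finset (Finset V)) (w : V)
    (Y : Finset V) : Prop :=
  Y ⊆ A ∧ w ∈ Y ∧
  (∀ D ∈ CH, D ⊆ Y ∨ D ∩ Y = ∅) ∧
  (∀ v ∈ A, v ∉ Y → (∃ y ∈ Y, Ht.Adj v y) → k ≤ ((Ht.neighborFinset v ∩ A) \ Y).card) ∧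
  (∀ D ∈ CH, (∃ d ∈ D, ∃ y ∈ Y, Ht.Adj d y) → D ⊆ Y)


theorem eBarIn_insert {V : Type*} [Fintype V] [DecidableEq V] (Ht : SimpleGraph V)
    [DecidableRel Ht.Adj] (A Y : Finset V) (v : V) (hv : v ∈ A) (hY : v ∉ Y) :
    eBarIn Ht A (insert v Y) = eBarIn Ht A Y + ((Ht.neighborFinset v ∩ A) \ Y).card := by
  unfold eBarIn
  have h1 : (Ht.edgeFinset.filter (fun e => (∀ u ∈ e, u ∈ A) ∧ ∃ u ∈ insert v Y, u ∈ e)) =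
      (Ht.edgeFinset.filter (fun e => (∀ u ∈ e, u ∈ A) ∧ ∃ u ∈ Y, u ∈ e)) ∪
      ((Ht.neighborFinset v ∩ A) \ Y).image (fun u => s(v, u)) := by
    ext e
    induction e using Sym2.ind with
    | _ a b =>
      simp only [Finset.mem_filter, Finset.mem_union, Finset.mem_image, Finset.mem_sdiff,
        Finset.mem_inter, SimpleGraph.mem_neighborFinset, Finset.mem_insert,
        SimpleGraph.mem_edgeFinset, SimpleGraph.mem_edgeSet, Sym2.mem_iff, Sym2.eq_iff]
      have hs := Ht.adj_comm a b
      constructor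
      · rintro ⟨hab, hA, u, hu, hue⟩
        by_cases hx : a ∈ Y ∨ b ∈ Y
        · left
          refine ⟨hab, hA, ?_⟩
          rcases hx with h | h
          · exact ⟨a, h, Or.inl rfl⟩
          · exact ⟨b, h, Or.inr rfl⟩
        · right
          push Not at hx
          rcases hu with rfl | hu
          · rcases hue with rfl | rfl
            · exact ⟨b, ⟨⟨hab, hA b (Or.inr rfl)⟩, hx.2⟩, Or.inl ⟨rfl, rfl⟩⟩
            · exact ⟨a, ⟨⟨hab.symm, hA a (Or.inl rfl)⟩, hx.1⟩, Or.inr ⟨rfl, rfl⟩⟩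
          · rcases hue with rfl | rfl
            · exact absurd hu hx.1
            · exact absurd hu hx.2
      · rintro (⟨hab, hA, u, hu, hue⟩ | ⟨u, ⟨⟨hvu, huA⟩, huY⟩, h | h⟩)
        · exact ⟨hab, hA, u, Or.inr hu, hue⟩
        · obtain ⟨rfl, rfl⟩ := h
          refine ⟨hvu, ?_, v, Or.inl rfl, Or.inl rfl⟩
          rintro x (rfl | rfl) <;> assumption
        · obtain ⟨rfl, rfl⟩ := h
          refine ⟨hvu.symm, ?_, v, Or.inl rfl, Or.inr rfl⟩
          rintro x (rfl | rfl) <;> assumption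
  rw [h1, Finset.card_union_of_disjoint, Finset.card_image_of_injective]
  · intro a b hab
    exact Sym2.congr_right.1 hab
  · rw [Finset.disjoint_left]
    intro e he he2
    simp only [Finset.mem_filter, Finset.mem_image, Finset.mem_sdiff] at he he2
    obtain ⟨u, ⟨_, huY⟩, rfl⟩ := he2
    obtain ⟨_, _, x, hx, hxe⟩ := he
    rcases Sym2.mem_iff.1 hxe with rfl | rfl
    · exact hY hx
    · exact huY hx

theorem eBarIn_union {V : Type*} [Fintype V] [DecidableEq V] (Ht : SimpleGraph V)
    [DecidableRel Ht.Adj] (A Y D : Finset V) (hYA : Y ⊆ A) (hDA : D ⊆ A)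
    (hadj : ∃ d ∈ D, ∃ y ∈ Y, Ht.Adj d y) :
    eBarIn Ht A (Y ∪ D) + 1 ≤ eBarIn Ht A Y + eBarIn Ht A D := by
  unfold eBarIn
  rw [← Finset.card_union_add_card_inter]
  apply Nat.add_le_add
  · apply Finset.card_le_card
    intro e he
    simp only [Finset.mem_filter, Finset.mem_union] at he ⊢
    obtain ⟨h1, h2, u, hu | hu, hue⟩ := he
    · exact Or.inl ⟨h1, h2, u, hu, hue⟩
    · exact Or.inr ⟨h1, h2, u, hu, hue⟩
  · rw [Nat.one_le_iff_ne_zero, ← Nat.pos_iff_ne_zero, Finset.card_pos]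
    obtain ⟨d, hd, y, hy, h⟩ := hadj
    have hA : ∀ u ∈ s(d, y), u ∈ A := by
      intro u hu
      rcases Sym2.mem_iff.1 hu with rfl | rfl
      · exact hDA hd
      · exact hYA hy
    refine ⟨s(d, y), ?_⟩
    simp only [Finset.mem_inter, Finset.mem_filter, SimpleGraph.mem_edgeFinset,
      SimpleGraph.mem_edgeSet]
    exact ⟨⟨h, hA, y, hy, Sym2.mem_mk_right _ _⟩, ⟨h, hA, d, hd, Sym2.mem_mk_left _ _⟩⟩

/-- Property (II) is preserved by adding a member of the collection. -/
theorem two_union {V : Type*} [DecidableEq V] (CH : Finset (Finset V))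
    (hCHdisj : ∀ D₁ ∈ CH, ∀ D₂ ∈ CH, D₁ ≠ D₂ → Disjoint D₁ D₂) (Y D : Finset V) (hD : D ∈ CH)
    (h2 : ∀ D ∈ CH, D ⊆ Y ∨ D ∩ Y = ∅) : ∀ E ∈ CH, E ⊆ Y ∪ D ∨ E ∩ (Y ∪ D) = ∅ := by
  intro E hE
  by_cases hED : E = D
  · left; rw [hED]; exact Finset.subset_union_right
  · rcases h2 E hE with h | h
    · left; exact h.trans Finset.subset_union_left
    · right
      rw [Finset.inter_union_distrib_left, h, Finset.empty_union]
      exact Finset.disjoint_iff_inter_eq_empty.1 (hCHdisj E hE D hD hED)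

/-- Property (II) is preserved by adding a vertex outside the members of the collection. -/
theorem two_insert {V : Type*} [DecidableEq V] (CH : Finset (Finset V))
    (Y : Finset V) (v : V) (hv : ∀ D ∈ CH, v ∉ D)
    (h2 : ∀ D ∈ CH, D ⊆ Y ∨ D ∩ Y = ∅) : ∀ E ∈ CH, E ⊆ insert v Y ∨ E ∩ insert v Y = ∅ := by
  intro E hE
  rcases h2 E hE with h | h
  · left; exact h.trans (Finset.subset_insert _ _)
  · right; rw [Finset.inter_insert_of_notMem (hv E hE), h]

theorem eBarIn_lower {V : Type*} [Fintype V] [DecidableEq V]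
    (k : ℕ) (hk : 2 ≤ k) (Ht : SimpleGraph V) [DecidableRel Ht.Adj]
    (VH : Finset V)
    (CH : Finset (Finset V))
    (hCHsub : ∀ D ∈ CH, D ⊆ VH)
    (hCHdisj : ∀ D₁ ∈ CH, ∀ D₂ ∈ CH, D₁ ≠ D₂ → Disjoint D₁ D₂)
    (hCHe : ∀ D ∈ CH, eBarIn Ht VH D ≤ (k - 1) * D.card + 1)
    (w : V)
    (ShH : Finset V) (hShH : WClosedIn k Ht VH CH w ShH)
    (hShHmin : ∀ Y : Finset V, WClosedIn k Ht VH CH w Y → ShH ⊆ Y)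
    (heq : eBarIn Ht VH ShH = (k - 1) * ShH.card) (n : ℕ) :
    ∀ Y : Finset V, Y ⊆ ShH → w ∈ Y → (∀ D ∈ CH, D ⊆ Y ∨ D ∩ Y = ∅) → (ShH \ Y).card ≤ n →
      (k - 1) * Y.card ≤ eBarIn Ht VH Y := by
  obtain ⟨hA, hwS, hS2, hS3, hS4⟩ := hShH
  induction n with
  | zero =>
    intro Y hY hwY h2 hn
    have : Y = ShH := by
      apply hY.antisymm
      rw [← Finset.sdiff_eq_empty_iff_subset]
      exact Finset.card_eq_zero.1 (by omega)
    rw [this, heq]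
  | succ n ih =>
    intro Y hY hwY h2 hn
    by_cases h4 : ∀ D ∈ CH, (∃ d ∈ D, ∃ y ∈ Y, Ht.Adj d y) → D ⊆ Y
    · by_cases h3 : ∀ v ∈ VH, v ∉ Y → (∃ y ∈ Y, Ht.Adj v y) →
          k ≤ ((Ht.neighborFinset v ∩ VH) \ Y).card
      · have : Y = ShH := hY.antisymm (hShHmin Y ⟨hY.trans hA, hwY, h2, h3, h4⟩)
        rw [this, heq]
      · push Not at h3
        obtain ⟨v, hvA, hvY, ⟨y, hy, hvy⟩, hlt⟩ := h3
        have hvS : v ∈ ShH := by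
          by_contra hvS
          have h := hS3 v hvA hvS ⟨y, hY hy, hvy⟩
          have := Finset.card_le_card
            (Finset.sdiff_subset_sdiff (Finset.Subset.refl (Ht.neighborFinset v ∩ VH)) hY)
          omega
        have hvD : ∀ D ∈ CH, v ∉ D := fun D hD hvD =>
          hvY (h4 D hD ⟨v, hvD, y, hy, hvy⟩ hvD)
        have hlt2 : (ShH \ insert v Y).card < (ShH \ Y).card := by
          apply Finset.card_lt_card
          rw [Finset.ssubset_iff_of_subset
            (Finset.sdiff_subset_sdiff (Finset.Subset.refl _) (Finset.subset_insert _ _))]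
          exact ⟨v, by simp [hvS, hvY], by simp⟩
        have := ih (insert v Y) (Finset.insert_subset hvS hY) (Finset.mem_insert_of_mem hwY)
          (two_insert CH Y v hvD h2) (by omega)
        rw [eBarIn_insert Ht VH Y v hvA hvY, Finset.card_insert_of_notMem hvY, mul_add] at this
        omega
    · push Not at h4
      obtain ⟨D, hD, ⟨d, hd, y, hy, hdy⟩, hDY⟩ := h4
      have hDS : D ⊆ ShH := hS4 D hD ⟨d, hd, y, hY hy, hdy⟩
      have hdisj : D ∩ Y = ∅ := (h2 D hD).resolve_left hDY
      have hdY : d ∉ Y := fun h => by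
        have : d ∈ D ∩ Y := Finset.mem_inter.2 ⟨hd, h⟩
        simp [hdisj] at this
      have hlt2 : (ShH \ (Y ∪ D)).card < (ShH \ Y).card := by
        apply Finset.card_lt_card
        rw [Finset.ssubset_iff_of_subset
          (Finset.sdiff_subset_sdiff (Finset.Subset.refl _) Finset.subset_union_left)]
        exact ⟨d, by simp [hDS hd, hdY], by simp [hd]⟩
      have h := ih (Y ∪ D) (Finset.union_subset hY hDS) (Finset.mem_union_left _ hwY)
        (two_union CH hCHdisj Y D hD h2) (by omega)
      have hu := eBarIn_union Ht VH Y D (hY.trans hA) (hCHsub D hD) ⟨d, hd, y, hy, hdy⟩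
      have he := hCHe D hD
      rw [Finset.card_union_of_disjoint
        (Finset.disjoint_iff_inter_eq_empty.2 hdisj).symm, mul_add] at h
      omega

/-- Lemma on shadows in a supergraph: let `H̃` (here: `Ht`) contain `H` (here: the subgraph
induced on the proper vertex subset `VH`) as a proper induced subgraph with no vertex outside
`VH` adjacent to any member of `C_H`. If `w ∈ V(H)` has `deg_{H̃}(w) ≤ k-1` and
`ē_H(sh_H(w)) = (k-1)·|sh_H(w)|`, then `sh_{H̃}(w) ⊆ sh_H(w)` and no vertex outside `V(H)` is
adjacent to any vertex of `sh_{H̃}(w)`. -/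
theorem shadow_in_supergraph {V : Type*} [Fintype V] [DecidableEq V]
    (k : ℕ) (hk : 2 ≤ k) (Ht : SimpleGraph V) [DecidableRel Ht.Adj]
    (VH : Finset V) (hproper : VH ≠ Finset.univ)
    (CH : Finset (Finset V))
    (hCHsub : ∀ D ∈ CH, D ⊆ VH)
    (hCHne : ∀ D ∈ CH, D.Nonempty)
    (hCHdisj : ∀ D₁ ∈ CH, ∀ D₂ ∈ CH, D₁ ≠ D₂ → Disjoint D₁ D₂)
    (hCHe : ∀ D ∈ CH, eBarIn Ht VH D ≤ (k - 1) * D.card + 1)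
    (hCHdeg : ∀ D ∈ CH, ∀ v ∈ D, k ≤ (Ht.neighborFinset v ∩ VH).card)
    (houtside : ∀ v ∉ VH, ∀ D ∈ CH, ∀ d ∈ D, ¬ Ht.Adj v d)
    (w : V) (hwVH : w ∈ VH) (hw : Ht.degree w ≤ k - 1)
    (ShH : Finset V) (hShH : WClosedIn k Ht VH CH w ShH)
    (hShHmin : ∀ Y : Finset V, WClosedIn k Ht VH CH w Y → ShH ⊆ Y)
    (heq : eBarIn Ht VH ShH = (k - 1) * ShH.card)
    (ShT : Finset V) (hShT : WClosedIn k Ht Finset.univ CH w ShT)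
    (hShTmin : ∀ Y : Finset V, WClosedIn k Ht Finset.univ CH w Y → ShT ⊆ Y) :
    ShT ⊆ ShH ∧ ∀ v ∉ VH, ∀ y ∈ ShT, ¬ Ht.Adj v y := by
  have low := fun Y h1 h2 h3 => eBarIn_lower k hk Ht VH CH hCHsub hCHdisj hCHe w ShH hShH hShHmin
    heq _ Y h1 h2 h3 le_rfl
  obtain ⟨hA, hwS, hS2, hS3, hS4⟩ := hShH
  have hwD : ∀ D ∈ CH, w ∉ D := by
    intro D hD hwD
    have h1 := hCHdeg D hD w hwD
    have h2 := Finset.card_le_card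
      (Finset.inter_subset_left : Ht.neighborFinset w ∩ VH ⊆ Ht.neighborFinset w)
    rw [SimpleGraph.card_neighborFinset_eq_degree] at h2
    omega
  -- if the degree into `VH` is at least the full degree then there are no outer neighbours
  have key : ∀ (Y : Finset V) (v : V), Y ⊆ VH →
      (Ht.neighborFinset v \ Y).card ≤ ((Ht.neighborFinset v ∩ VH) \ Y).card →
      ∀ u ∉ VH, ¬ Ht.Adj u v := by
    intro Y v hY hc u hu huv
    have hsub : (Ht.neighborFinset v ∩ VH) \ Y ⊆ Ht.neighborFinset v \ Y :=
      Finset.sdiff_subset_sdiff Finset.inter_subset_left (Finset.Subset.refl _)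
    have he := Finset.eq_of_subset_of_card_le hsub hc
    have : u ∈ Ht.neighborFinset v \ Y := by
      simp only [Finset.mem_sdiff, SimpleGraph.mem_neighborFinset]
      exact ⟨huv.symm, fun h => hu (hY h)⟩
    rw [← he] at this
    simp [hu] at this
  let P : Finset V → Prop := fun Y => Y ⊆ ShH ∧ w ∈ Y ∧ (∀ D ∈ CH, D ⊆ Y ∨ D ∩ Y = ∅) ∧
    eBarIn Ht VH Y ≤ (k - 1) * Y.card ∧ ∀ v ∉ VH, ∀ y ∈ Y, ¬ Ht.Adj v y
  have hP0 : P {w} := by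
    have h2 : ∀ D ∈ CH, D ⊆ {w} ∨ D ∩ {w} = ∅ := by
      intro D hD
      right
      exact Finset.inter_singleton_of_notMem (hwD D hD)
    have hs : ({w} : Finset V) ⊆ ShH := Finset.singleton_subset_iff.2 hwS
    have hl := low {w} hs (Finset.mem_singleton_self w) h2
    have he := eBarIn_insert Ht VH ∅ w hwVH (Finset.notMem_empty w)
    have h0 : eBarIn Ht VH ∅ = 0 := by simp [eBarIn]
    have hcl := Finset.card_le_card
      (Finset.inter_subset_left : Ht.neighborFinset w ∩ VH ⊆ Ht.neighborFinset w)
    rw [SimpleGraph.card_neighborFinset_eq_degree] at hcl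
    rw [insert_empty_eq, h0, Finset.sdiff_empty, zero_add] at he
    rw [Finset.card_singleton, mul_one] at hl
    refine ⟨hs, Finset.mem_singleton_self w, h2, ?_, ?_⟩
    · rw [Finset.card_singleton]; omega
    · intro v hv y hy
      rw [Finset.mem_singleton] at hy
      subst hy
      refine key ∅ y (Finset.empty_subset _) ?_ v hv
      rw [Finset.sdiff_empty, Finset.sdiff_empty, SimpleGraph.card_neighborFinset_eq_degree]
      omega
  classical
  obtain ⟨Y, hYm, hmax⟩ := Finset.exists_max_image (Finset.univ.filter P) Finset.card
    ⟨{w}, by simpa using hP0⟩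
  have hYP : P Y := by simpa using hYm
  have hmax' : ∀ Z, P Z → Z.card ≤ Y.card := fun Z hZ => hmax Z (by simpa using hZ)
  obtain ⟨hYS, hwY, hY2, hYe, hYo⟩ := hYP
  have hlow := low Y hYS hwY hY2
  have hY4 : ∀ D ∈ CH, (∃ d ∈ D, ∃ y ∈ Y, Ht.Adj d y) → D ⊆ Y := by
    rintro D hD ⟨d, hd, y, hy, hdy⟩
    by_contra hDY
    have hDS : D ⊆ ShH := hS4 D hD ⟨d, hd, y, hYS hy, hdy⟩
    have hdisj := (Finset.disjoint_iff_inter_eq_empty.2 ((hY2 D hD).resolve_left hDY)).symm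
    have hu := eBarIn_union Ht VH Y D (hYS.trans hA) (hCHsub D hD) ⟨d, hd, y, hy, hdy⟩
    have he := hCHe D hD
    have hc := Finset.card_union_of_disjoint hdisj
    have hpos : 0 < D.card := Finset.card_pos.2 ⟨d, hd⟩
    have := hmax' (Y ∪ D) ⟨Finset.union_subset hYS hDS, Finset.mem_union_left _ hwY,
      two_union CH hCHdisj Y D hD hY2, by rw [hc, mul_add]; omega, by
        intro v hv x hx
        rcases Finset.mem_union.1 hx with hx | hx
        · exact hYo v hv x hx
        · exact houtside v hv D hD x hx⟩
    omega
  have hcl : WClosedIn k Ht Finset.univ CH w Y := by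
    refine ⟨Finset.subset_univ _, hwY, hY2, ?_, hY4⟩
    rintro v - hvY ⟨y, hy, hvy⟩
    rw [Finset.inter_univ]
    by_contra hlt
    have hvA : v ∈ VH := by
      by_contra h
      exact hYo v h y hy hvy
    have hle : ((Ht.neighborFinset v ∩ VH) \ Y).card ≤ (Ht.neighborFinset v \ Y).card :=
      Finset.card_le_card (Finset.sdiff_subset_sdiff Finset.inter_subset_left
        (Finset.Subset.refl _))
    have hvS : v ∈ ShH := by
      by_contra hvS
      have h := hS3 v hvA hvS ⟨y, hYS hy, hvy⟩
      have := Finset.card_le_card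
        (Finset.sdiff_subset_sdiff (Finset.Subset.refl (Ht.neighborFinset v ∩ VH)) hYS)
      omega
    have hvD : ∀ D ∈ CH, v ∉ D := fun D hD hvD =>
      hvY (hY4 D hD ⟨v, hvD, y, hy, hvy⟩ hvD)
    have hi2 := two_insert CH Y v hvD hY2
    have hl := low (insert v Y) (Finset.insert_subset hvS hYS) (Finset.mem_insert_of_mem hwY) hi2
    have he := eBarIn_insert Ht VH Y v hvA hvY
    have hc := Finset.card_insert_of_notMem hvY
    rw [hc, mul_add] at hl
    have := hmax' (insert v Y) ⟨Finset.insert_subset hvS hYS, Finset.mem_insert_of_mem hwY, hi2,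
      by rw [hc, mul_add]; omega, by
        intro u hu x hx
        rcases Finset.mem_insert.1 hx with rfl | hx
        · exact key Y x (hYS.trans hA) (by omega) u hu
        · exact hYo u hu x hx⟩
    omega
  have hsub := hShTmin Y hcl
  exact ⟨hsub.trans hYS, fun v hv y hy => hYo v hv y (hsub hy)⟩
end
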